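/- arXiv:2604.20294 — 3 statements merged into one kernel-verified Lean document; each statement's English description precedes it below -/
import Mathlib

section
/- Let X be an Archimedean lattice-ordered algebra with multiplicative identity 1_X, let n ∈ ℕ and let x₁, …, xₙ ∈ X. Then the following three conditions are equivalent: (i) there is a lattice-algebra homomorphism Ψ : PG_n → X with Ψ(𝟙) = 1_X and Ψ(πᵢ) = xᵢ for i = 1, …, n; (ii) setting e = 1_X ∨ |x₁| ∨ ⋯ ∨ |xₙ|, there exists an f-subalgebra Y of X with 1_X, x₁, …, xₙ ∈ Y such that for every m ∈ ℕ the norm ‖·‖_{e^m} is complete on Y ∩ I_{e^m} (i.e., every ‖·‖_{e^m}-Cauchy sequence in Y ∩ I_{e^m} converges in ‖·‖_{e^m} to an element of Y ∩ I_{e^m}); (iii) there exist f ∈ X with f ≥ 1_X ∨ |x₁| ∨ ⋯ ∨ |xₙ| and an f-subalgebra Y of X with 1_X, x₁, …, xₙ ∈ Y such that for every m ∈ ℕ the norm ‖·‖_{f^m} is complete on Y ∩ I_{f^m}. -/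
open scoped BigOperators

/-- A continuous function `ℝⁿ → ℝ` of polynomial growth (an element of `PG_n`). -/
def PolyGrowth (n : ℕ) (f : (Fin n → ℝ) → ℝ) : Prop :=
  Continuous f ∧ ∃ (M : ℝ) (N : ℕ), 0 ≤ M ∧
    ∀ t : Fin n → ℝ, |f t| ≤ M * (1 + ∑ i : Fin n, |t i|) ^ N

/-- An element of `PG_n^h`: a polynomial growth continuous function `f` such that
`f (t • x) / t` converges as `t → 0⁺`, uniformly in `x` on every bounded set. -/
def PolyGrowthH (n : ℕ) (f : (Fin n → ℝ) → ℝ) : Prop :=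
  PolyGrowth n f ∧ ∃ fh : (Fin n → ℝ) → ℝ,
    ∀ B : Set (Fin n → ℝ), Bornology.IsBounded B →
      ∀ ε : ℝ, 0 < ε → ∃ δ : ℝ, 0 < δ ∧
        ∀ t : ℝ, 0 < t → t < δ → ∀ y ∈ B, |f (t • y) / t - fh y| < ε

/-- An element of `H_n`: a continuous positively homogeneous function `ℝⁿ → ℝ`. -/
def PosHomog (n : ℕ) (f : (Fin n → ℝ) → ℝ) : Prop :=
  Continuous f ∧ ∀ (c : ℝ), 0 ≤ c → ∀ t : Fin n → ℝ, f (c • t) = c * f t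

section Defs

variable {X : Type*} [Lattice X] [AddCommGroup X] [Module ℝ X]

/-- The order ideal `I_e` generated by `e`. -/
def idealSet (e : X) : Set X := {x : X | ∃ c : ℝ, 0 ≤ c ∧ |x| ≤ c • e}

/-- The norm `‖x‖_e = inf {c ≥ 0 : |x| ≤ c • e}`. -/
noncomputable def regNorm (e x : X) : ℝ := sInf {c : ℝ | 0 ≤ c ∧ |x| ≤ c • e}

/-- The norm `‖·‖_e` is complete on the set `S`: every `‖·‖_e`-Cauchy sequence in `S`
converges, in `‖·‖_e`, to an element of `S`. -/
def NormComplete (e : X) (S : Set X) : Prop :=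
  ∀ u : ℕ → X, (∀ k, u k ∈ S) →
    (∀ ε : ℝ, 0 < ε → ∃ N : ℕ, ∀ p q : ℕ, N ≤ p → N ≤ q → regNorm e (u p - u q) < ε) →
    ∃ x ∈ S, ∀ ε : ℝ, 0 < ε → ∃ N : ℕ, ∀ p : ℕ, N ≤ p → regNorm e (u p - x) < ε

/-- A uniformly complete vector lattice: `(I_e, ‖·‖_e)` is complete for every `e ≥ 0`. -/
def UniformlyComplete (X : Type*) [Lattice X] [AddCommGroup X] [Module ℝ X] : Prop :=
  ∀ e : X, 0 ≤ e → NormComplete e (idealSet e)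

/-- A subset `Z` is uniformly complete as a vector lattice in its own right. -/
def UCSet (Z : Set X) : Prop :=
  ∀ e ∈ Z, 0 ≤ e → NormComplete e (Z ∩ idealSet e)

/-- A (vector) sublattice: a linear subspace closed under binary suprema. -/
def IsSublatticeSet (Z : Set X) : Prop :=
  (0 ∈ Z) ∧ (∀ a ∈ Z, ∀ b ∈ Z, a + b ∈ Z) ∧ (∀ (c : ℝ), ∀ a ∈ Z, c • a ∈ Z) ∧
  (∀ a ∈ Z, -a ∈ Z) ∧ (∀ a ∈ Z, ∀ b ∈ Z, a ⊔ b ∈ Z) ∧ (∀ a ∈ Z, ∀ b ∈ Z, a ⊓ b ∈ Z)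

/-- An order ideal: a linear subspace that is solid. -/
def IsOrderIdealSet (I : Set X) : Prop :=
  (0 ∈ I) ∧ (∀ a ∈ I, ∀ b ∈ I, a + b ∈ I) ∧ (∀ (c : ℝ), ∀ a ∈ I, c • a ∈ I) ∧
  (∀ a ∈ I, ∀ b : X, |b| ≤ |a| → b ∈ I)

/-- A vector lattice homomorphism defined on the class of functions `ℝⁿ → ℝ`
satisfying the predicate `P` (with pointwise operations), taking values in `X`. -/
def IsLatHom {n : ℕ} (P : ((Fin n → ℝ) → ℝ) → Prop) (Φ : ∀ f, P f → X) : Prop :=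
  (∀ (f g : (Fin n → ℝ) → ℝ) (hf : P f) (hg : P g) (hfg : P (f + g)),
      Φ (f + g) hfg = Φ f hf + Φ g hg) ∧
  (∀ (c : ℝ) (f : (Fin n → ℝ) → ℝ) (hf : P f) (hcf : P (c • f)),
      Φ (c • f) hcf = c • Φ f hf) ∧
  (∀ (f g : (Fin n → ℝ) → ℝ) (hf : P f) (hg : P g) (hfg : P (f ⊔ g)),
      Φ (f ⊔ g) hfg = Φ f hf ⊔ Φ g hg)

end Defs

section MulDefs

variable {X : Type*} [Lattice X] [AddCommGroup X] [Module ℝ X] [Mul X]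

/-- A lattice-algebra homomorphism defined on the class of functions `ℝⁿ → ℝ`
satisfying the predicate `P` (with pointwise operations), taking values in `X`. -/
def IsLatAlgHom {n : ℕ} (P : ((Fin n → ℝ) → ℝ) → Prop) (Ψ : ∀ f, P f → X) : Prop :=
  IsLatHom P Ψ ∧
  (∀ (f g : (Fin n → ℝ) → ℝ) (hf : P f) (hg : P g) (hfg : P (f * g)),
      Ψ (f * g) hfg = Ψ f hf * Ψ g hg)

/-- A sublattice-algebra: a linear subspace that is both a sublattice and a subalgebra. -/
def IsSublatticeAlgebraSet (Z : Set X) : Prop :=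
  IsSublatticeSet Z ∧ ∀ a ∈ Z, ∀ b ∈ Z, a * b ∈ Z

/-- The `f`-algebra condition, relativized to a subset. -/
def IsFAlgebraSet (Z : Set X) : Prop :=
  ∀ a ∈ Z, ∀ b ∈ Z, ∀ z ∈ Z, a ⊓ b = 0 → 0 ≤ z → (z * a) ⊓ b = 0 ∧ (a * z) ⊓ b = 0

/-- An `f`-subalgebra: a sublattice-algebra which is itself an `f`-algebra. -/
def IsFSubalgebra (Z : Set X) : Prop := IsSublatticeAlgebraSet Z ∧ IsFAlgebraSet Z

/-- `powS e m = e^(m+1)`, defined without assuming an identity element. -/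
def powS (e : X) : ℕ → X
  | 0 => e
  | m + 1 => powS e m * e

end MulDefs

/-- A map `T : X → A` which is a lattice-algebra homomorphism on a subset `S` of `X`. -/
def IsLatAlgHomOn {X A : Type*} [Lattice X] [AddCommGroup X] [Module ℝ X] [Mul X]
    [Lattice A] [AddCommGroup A] [Module ℝ A] [Mul A] (S : Set X) (T : X → A) : Prop :=
  (∀ a ∈ S, ∀ b ∈ S, T (a + b) = T a + T b) ∧
  (∀ (c : ℝ), ∀ a ∈ S, T (c • a) = c • T a) ∧
  (∀ a ∈ S, ∀ b ∈ S, T (a ⊔ b) = T a ⊔ T b) ∧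
  (∀ a ∈ S, ∀ b ∈ S, T (a * b) = T a * T b)

lemma nonpos_of_forall_le_smul {X : Type*} [Lattice X] [AddCommGroup X] [Module ℝ X]
    [IsOrderedAddMonoid X] [IsOrderedModule ℝ X]
    (harch : ∀ y z : X, 0 ≤ y → (∀ k : ℕ, k • y ≤ z) → y = 0) {y z : X}
    (h : ∀ ε : ℝ, 0 < ε → y ≤ ε • z) : y ≤ 0 := by
  have hy : y⁺ = 0 := by
    refine harch _ z⁺ (posPart_nonneg y) fun k => ?_
    have hz : y ≤ ((k : ℝ) + 1)⁻¹ • z⁺ :=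
      (h _ (by positivity)).trans (smul_le_smul_of_nonneg_left (le_posPart z) (by positivity))
    have h1 : y⁺ ≤ ((k : ℝ) + 1)⁻¹ • z⁺ :=
      sup_le hz (smul_nonneg (by positivity) (posPart_nonneg z))
    calc k • y⁺ = (k : ℝ) • y⁺ := (Nat.cast_smul_eq_nsmul ℝ k _).symm
      _ ≤ ((k : ℝ) + 1) • y⁺ := smul_le_smul_of_nonneg_right (by linarith) (posPart_nonneg y)
      _ ≤ ((k : ℝ) + 1) • ((k : ℝ) + 1)⁻¹ • z⁺ := smul_le_smul_of_nonneg_left h1 (by positivity)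
      _ = z⁺ := smul_inv_smul₀ (by positivity) _
  exact (le_posPart y).trans hy.le

/-- An Archimedean `f`-algebra over `ℝ` with a positive identity element. -/
class IsArchimedeanFAlgebra (A : Type*) [Lattice A] [Ring A] [Algebra ℝ A] : Prop
    extends IsOrderedRing A, IsOrderedModule ℝ A where
  eq_zero_of_nsmul_le : ∀ y z : A, 0 ≤ y → (∀ k : ℕ, k • y ≤ z) → y = 0
  mul_inf_eq_zero : ∀ a b z : A, a ⊓ b = 0 → 0 ≤ z → (z * a) ⊓ b = 0
  inf_mul_eq_zero : ∀ a b z : A, a ⊓ b = 0 → 0 ≤ z → (a * z) ⊓ b = 0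

namespace IsArchimedeanFAlgebra

variable {A : Type*} [Lattice A] [Ring A] [Algebra ℝ A] [IsArchimedeanFAlgebra A]

lemma nonpos_of_le_smul {y z : A} (h : ∀ ε : ℝ, 0 < ε → y ≤ ε • z) : y ≤ 0 :=
  nonpos_of_forall_le_smul eq_zero_of_nsmul_le h

lemma eq_of_abs_sub_le_smul {x y z : A} (h : ∀ ε : ℝ, 0 < ε → |x - y| ≤ ε • z) : x = y := by
  have h0 := abs_le'.1 (nonpos_of_le_smul h)
  exact sub_eq_zero.1 (le_antisymm h0.1 (neg_nonpos.1 h0.2))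

lemma mul_eq_zero_of_inf_eq_zero {a b : A} (h : a ⊓ b = 0) : a * b = 0 := by
  have ha : 0 ≤ a := h ▸ inf_le_left
  have hb : 0 ≤ b := h ▸ inf_le_right
  have h1 := inf_mul_eq_zero a b b h hb
  rw [inf_comm] at h1
  have h2 := mul_inf_eq_zero b (a * b) a h1 ha
  simpa using h2

lemma posPart_mul_negPart (a : A) : a⁺ * a⁻ = 0 :=
  mul_eq_zero_of_inf_eq_zero (posPart_inf_negPart_eq_zero a)

lemma mul_sup_of_nonneg {z : A} (hz : 0 ≤ z) (a b : A) : z * (a ⊔ b) = z * a ⊔ z * b := by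
  have h : (a ⊔ b - a) ⊓ (a ⊔ b - b) = 0 := by
    rw [← sub_sup, sub_self]
  have h1 := mul_inf_eq_zero _ _ z h hz
  rw [inf_comm] at h1
  have h2 := mul_inf_eq_zero _ _ z h1 hz
  rw [mul_sub, mul_sub, inf_comm, ← sub_sup, sub_eq_zero] at h2
  exact h2

lemma abs_mul_of_nonneg {z : A} (hz : 0 ≤ z) (a : A) : |z * a| = z * |a| := by
  rw [abs, abs, mul_sup_of_nonneg hz, mul_neg]

/-- The positive unital linear functionals on `A`. -/
def stateSpace (A : Type*) [Lattice A] [Ring A] [Algebra ℝ A] : Set (A → ℝ) :=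
  {ω | (∀ a b, ω (a + b) = ω a + ω b) ∧ (∀ (c : ℝ) a, ω (c • a) = c * ω a) ∧ ω 1 = 1 ∧
    ∀ a, 0 ≤ a → 0 ≤ ω a}

lemma exists_mem_stateSpace (hb : ∀ a : A, ∃ c : ℝ, |a| ≤ c • 1) {a : A} (ha : ¬ 0 ≤ a) :
    ∃ ω ∈ stateSpace A, ω a < 0 := by
  obtain ⟨ε, hε, haε⟩ : ∃ ε : ℝ, 0 < ε ∧ ¬ 0 ≤ a + ε • (1 : A) := by
    by_contra! h
    refine ha (neg_nonpos.1 (nonpos_of_le_smul (z := (1 : A)) fun ε hε => ?_))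
    exact neg_le_iff_add_nonneg'.2 (h ε hε)
  have hone : (1 : A) ≠ 0 := fun h => ha (by
    rw [← one_mul a, h, zero_mul])
  let C : PointedCone ℝ A :=
    { carrier := {b | ∃ t : ℝ, 0 ≤ t ∧ 0 ≤ b + t • (a + ε • (1 : A))}
      zero_mem' := ⟨0, le_rfl, by simp⟩
      add_mem' := by
        rintro b b' ⟨t, ht, hbt⟩ ⟨t', ht', hbt'⟩
        refine ⟨t + t', add_nonneg ht ht', ?_⟩
        rw [add_smul, add_add_add_comm]
        exact add_nonneg hbt hbt'
      smul_mem' := by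
        rintro ⟨c, hc⟩ b ⟨t, ht, hbt⟩
        refine ⟨c * t, mul_nonneg hc ht, ?_⟩
        rw [mul_smul]
        change 0 ≤ c • b + _
        rw [← smul_add]
        exact smul_nonneg hc hbt }
  have hC : ∀ b : A, 0 ≤ b → b ∈ C := fun b hb => ⟨0, le_rfl, by simpa using hb⟩
  have hCa : -(a + ε • (1 : A)) ∈ C := ⟨1, zero_le_one, by simp⟩
  let f : A →ₗ.[ℝ] ℝ := LinearPMap.mkSpanSingleton (σ := RingHom.id ℝ) (1 : A) (1 : ℝ) hone
  have hf : ∀ (c : ℝ) (h : c • (1 : A) ∈ f.domain), f ⟨c • (1 : A), h⟩ = c := by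
    intro c h
    refine (LinearPMap.mkSpanSingleton'_apply (σ := RingHom.id ℝ) (1 : A) (1 : ℝ)
      (fun c hc => by simpa [hone] using hc) c h).trans ?_
    simp
  have hmem : ∀ c : ℝ, c • (1 : A) ∈ f.domain := fun c => Submodule.mem_span_singleton.2 ⟨c, rfl⟩
  obtain ⟨g, hg, hgC⟩ := riesz_extension C f (by
    rintro ⟨b, hbd⟩ ⟨t, ht, hbt⟩
    obtain ⟨c, rfl⟩ := Submodule.mem_span_singleton.1 hbd
    rw [hf]
    by_contra! hc
    simp only at hbt
    rcases ht.eq_or_lt with rfl | ht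
    · simp only [zero_smul, add_zero] at hbt
      have h1 : (-c) • (1 : A) ≤ 0 := by rw [neg_smul]; exact neg_nonpos.2 hbt
      have h2 : (1 : A) ≤ 0 := by
        have := smul_le_smul_of_nonneg_left h1 (a := (-c)⁻¹) (by
          have : 0 < -c := by linarith
          positivity)
        rwa [inv_smul_smul₀ (by linarith), smul_zero] at this
      exact hone (le_antisymm h2 zero_le_one)
    · apply haε
      have h1 : 0 ≤ t • (a + ε • (1 : A)) := by
        refine hbt.trans ?_
        have : c • (1 : A) ≤ 0 := smul_nonpos_of_nonpos_of_nonneg hc.le zero_le_one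
        simpa using this
      have := smul_nonneg (inv_nonneg.2 ht.le) h1
      rwa [inv_smul_smul₀ ht.ne'] at this) (by
    intro b
    obtain ⟨c, hc⟩ := hb b
    refine ⟨⟨c • 1, hmem c⟩, hC _ ?_⟩
    have := (neg_le_abs b).trans hc
    exact neg_le_iff_add_nonneg.1 this)
  have hg1 : g 1 = 1 := by
    have h1 := hg ⟨(1 : ℝ) • 1, hmem 1⟩
    rw [hf] at h1
    simpa using h1
  refine ⟨g, ⟨fun _ _ => map_add g _ _, fun c b => by simp, hg1, fun b hb => hgC b (hC b hb)⟩, ?_⟩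
  have := hgC _ hCa
  rw [map_neg, map_add, map_smul, hg1, smul_eq_mul, mul_one] at this
  linarith

omit [IsArchimedeanFAlgebra A] in
lemma convex_stateSpace : Convex ℝ (stateSpace A) := by
  rintro ω ⟨h1, h2, h3, h4⟩ ω' ⟨h1', h2', h3', h4'⟩ s t hs ht hst
  refine ⟨fun a b => ?_, fun c a => ?_, ?_, fun a ha => ?_⟩
  · simp only [Pi.add_apply, Pi.smul_apply, smul_eq_mul, h1, h1']; ring
  · simp only [Pi.add_apply, Pi.smul_apply, smul_eq_mul, h2, h2']; ring
  · simp only [Pi.add_apply, Pi.smul_apply, smul_eq_mul, h3, h3']; linarith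
  · simp only [Pi.add_apply, Pi.smul_apply, smul_eq_mul]
    exact add_nonneg (mul_nonneg hs (h4 a ha)) (mul_nonneg ht (h4' a ha))

lemma abs_apply_le_of_mem_stateSpace {ω : A → ℝ} (hω : ω ∈ stateSpace A) {a : A} {c : ℝ}
    (h : |a| ≤ c • 1) : |ω a| ≤ c := by
  obtain ⟨h1, h2, h3, h4⟩ := hω
  have e1 := h4 (c • 1 + (-1 : ℝ) • a) (by
    rw [neg_one_smul, ← sub_eq_add_neg]
    exact sub_nonneg.2 ((le_abs_self a).trans h))
  have e2 := h4 (c • 1 + a) (neg_le_iff_add_nonneg.1 ((neg_le_abs a).trans h))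
  rw [h1, h2, h2, h3] at e1
  rw [h1, h2, h3] at e2
  exact abs_le.2 ⟨by linarith, by linarith⟩

omit [IsArchimedeanFAlgebra A] in
lemma isClosed_stateSpace : IsClosed (stateSpace A) := by
  simp only [stateSpace, Set.ofPred_and, Set.ofPred_forall]
  refine IsClosed.inter ?_ (IsClosed.inter ?_ (IsClosed.inter ?_ ?_))
  · exact isClosed_iInter fun a => isClosed_iInter fun b =>
      isClosed_eq (by fun_prop) (by fun_prop)
  · exact isClosed_iInter fun a => isClosed_iInter fun b =>
      isClosed_eq (by fun_prop) (by fun_prop)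
  · exact isClosed_eq (by fun_prop) (by fun_prop)
  · exact isClosed_iInter fun a => isClosed_iInter fun b =>
      isClosed_le (by fun_prop) (by fun_prop)

lemma isCompact_stateSpace (hb : ∀ a : A, ∃ c : ℝ, |a| ≤ c • 1) : IsCompact (stateSpace A) := by
  choose c hc using hb
  refine (isCompact_univ_pi fun a : A => isCompact_Icc (a := -c a) (b := c a)).of_isClosed_subset
    isClosed_stateSpace fun ω hω a _ => ?_
  exact abs_le.1 (abs_apply_le_of_mem_stateSpace hω (hc a))

/-- The positive unital algebra homomorphisms `A → ℝ`. -/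
def charSpace (A : Type*) [Lattice A] [Ring A] [Algebra ℝ A] : Set (A → ℝ) :=
  {ω | ω ∈ stateSpace A ∧ ∀ a b, ω (a * b) = ω a * ω b}

lemma extremePoints_stateSpace_subset (hb : ∀ a : A, ∃ c : ℝ, |a| ≤ c • 1) :
    (stateSpace A).extremePoints ℝ ⊆ charSpace A := by
  intro ω hω
  obtain ⟨hωS, hext⟩ := mem_extremePoints.1 hω
  refine ⟨hωS, fun a d => ?_⟩
  obtain ⟨h1, h2, h3, h4⟩ := id hωS
  obtain ⟨c, hc⟩ := hb a
  have hω_sub : ∀ a b, ω (a - b) = ω a - ω b := fun a b => by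
    rw [sub_eq_add_neg, ← neg_one_smul ℝ b, h1, h2]; ring
  set k : ℝ := 1 / (4 * (|c| + 1)) with hk
  have hkpos : 0 < k := by positivity
  have hkc : k * |c| ≤ 1 / 4 := by
    rw [hk, div_mul_eq_mul_div, one_mul, div_le_div_iff₀ (by positivity) (by positivity)]
    linarith [abs_nonneg c]
  have hka : |k • a| ≤ (1 / 4 : ℝ) • (1 : A) := by
    have h5 : |a| ≤ |c| • (1 : A) :=
      hc.trans (smul_le_smul_of_nonneg_right (le_abs_self c) zero_le_one)
    have h6 : k • |a| ≤ k • |c| • (1 : A) := smul_le_smul_of_nonneg_left h5 hkpos.le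
    have h7 : |k • a| ≤ k • |a| := by
      refine abs_le'.2 ⟨smul_le_smul_of_nonneg_left (le_abs_self a) hkpos.le, ?_⟩
      rw [← smul_neg]
      exact smul_le_smul_of_nonneg_left (neg_le_abs a) hkpos.le
    refine h7.trans (h6.trans ?_)
    rw [smul_smul]
    exact smul_le_smul_of_nonneg_right hkc zero_le_one
  have hωk := abs_le.1 (abs_apply_le_of_mem_stateSpace hωS hka)
  -- the functional `ω` is a convex combination of `b ↦ ω (h * b)` and `b ↦ ω ((1 - h) * b)`
  have key : ∀ h : A, 0 ≤ h → h ≤ 1 → 0 < ω h → ω h < 1 → ∀ b, ω (h * b) = ω h * ω b := by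
    intro h hh0 hh1 hp hq b
    have hq' : 0 < 1 - ω h := by linarith
    let φ : A → ℝ := fun b => (ω h)⁻¹ * ω (h * b)
    let ψ : A → ℝ := fun b => (1 - ω h)⁻¹ * (ω b - ω (h * b))
    have hφ : φ ∈ stateSpace A := by
      refine ⟨fun a b => ?_, fun c b => ?_, ?_, fun b hb => ?_⟩
      · simp only [φ, mul_add, h1]
      · simp only [φ, mul_smul_comm, h2]; ring
      · simp only [φ, mul_one]; exact inv_mul_cancel₀ hp.ne'
      · exact mul_nonneg (inv_nonneg.2 hp.le) (h4 _ (mul_nonneg hh0 hb))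
    have hψ : ψ ∈ stateSpace A := by
      refine ⟨fun a b => ?_, fun c b => ?_, ?_, fun b hb => ?_⟩
      · simp only [ψ, mul_add, h1]; ring
      · simp only [ψ, mul_smul_comm, h2]; ring
      · simp only [ψ, mul_one, h3]; exact inv_mul_cancel₀ hq'.ne'
      · refine mul_nonneg (inv_nonneg.2 hq'.le) ?_
        rw [← hω_sub]
        refine h4 _ ?_
        rw [← one_sub_mul]
        exact mul_nonneg (sub_nonneg.2 hh1) hb
    have hmem : ω ∈ openSegment ℝ φ ψ := by
      refine ⟨ω h, 1 - ω h, hp, hq', by ring, ?_⟩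
      funext b
      simp only [φ, ψ, Pi.add_apply, Pi.smul_apply, smul_eq_mul]
      rw [mul_inv_cancel_left₀ hp.ne', mul_inv_cancel_left₀ hq'.ne']
      ring
    have := congrFun (hext φ hφ ψ hψ hmem).1 b
    simp only [φ] at this
    rw [← this, mul_inv_cancel_left₀ hp.ne']
  have hval : ω ((1 / 2 : ℝ) • 1 + k • a) = 1 / 2 + ω (k • a) := by
    rw [h1, h2, h3]; ring
  have h8 := key ((1 / 2 : ℝ) • 1 + k • a) (by
      have h9 : -(k • a) ≤ (1 / 2 : ℝ) • (1 : A) := (neg_le_abs _).trans (hka.trans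
        (smul_le_smul_of_nonneg_right (by norm_num) zero_le_one))
      exact neg_le_iff_add_nonneg.1 h9) (by
      have h9 : k • a ≤ (1 / 2 : ℝ) • (1 : A) := (le_abs_self _).trans (hka.trans
        (smul_le_smul_of_nonneg_right (by norm_num) zero_le_one))
      calc (1 / 2 : ℝ) • 1 + k • a ≤ (1 / 2 : ℝ) • (1 : A) + (1 / 2 : ℝ) • (1 : A) := by gcongr
        _ = 1 := by rw [← add_smul]; norm_num) (by rw [hval]; linarith [hωk.1])
      (by rw [hval]; linarith [hωk.2]) d
  rw [hval, add_mul, smul_mul_assoc, one_mul, smul_mul_assoc, h1, h2, h2, h2] at h8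
  have h9 : k * (ω (a * d) - ω a * ω d) = 0 := by linear_combination h8
  rcases mul_eq_zero.1 h9 with h | h
  · exact absurd h hkpos.ne'
  · linarith

lemma nonneg_of_forall_charSpace (hb : ∀ a : A, ∃ c : ℝ, |a| ≤ c • 1) {a : A}
    (h : ∀ ω ∈ charSpace A, 0 ≤ ω a) : 0 ≤ a := by
  by_contra ha
  obtain ⟨ω, hω, hωa⟩ := exists_mem_stateSpace hb ha
  rw [← closure_convexHull_extremePoints (isCompact_stateSpace hb) convex_stateSpace] at hω
  have hsub : closure (convexHull ℝ ((stateSpace A).extremePoints ℝ)) ⊆ {ω | 0 ≤ ω a} := by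
    refine closure_minimal (convexHull_min
      (fun ω hω => h ω (extremePoints_stateSpace_subset hb hω)) ?_)
      (isClosed_le (by fun_prop) (by fun_prop))
    intro ω hω ω' hω' s t hs ht _
    exact add_nonneg (mul_nonneg hs hω) (mul_nonneg ht hω')
  exact absurd (hsub hω) (not_le.2 hωa)

lemma isCompact_charSpace (hb : ∀ a : A, ∃ c : ℝ, |a| ≤ c • 1) : IsCompact (charSpace A) := by
  refine (isCompact_stateSpace hb).of_isClosed_subset ?_ fun ω hω => hω.1
  refine isClosed_stateSpace.inter
    (s₂ := {ω : A → ℝ | ∀ a b, ω (a * b) = ω a * ω b}) ?_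
  simp only [Set.ofPred_forall]
  exact isClosed_iInter fun a => isClosed_iInter fun b =>
      isClosed_eq (by fun_prop) (by fun_prop)

omit [IsArchimedeanFAlgebra A] in
lemma apply_sub_of_mem_charSpace {ω : A → ℝ} (hω : ω ∈ charSpace A) (a b : A) :
    ω (a - b) = ω a - ω b := by
  rw [sub_eq_add_neg, ← neg_one_smul ℝ b, hω.1.1, hω.1.2.1]; ring

lemma apply_abs_of_mem_charSpace {ω : A → ℝ} (hω : ω ∈ charSpace A) (a : A) :
    ω |a| = |ω a| := by
  obtain ⟨⟨h1, h2, h3, h4⟩, h5⟩ := id hω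
  have hp := h4 _ (posPart_nonneg a)
  have hn := h4 _ (negPart_nonneg a)
  have h0 : ω (a⁺) * ω (a⁻) = 0 := by
    rw [← h5, posPart_mul_negPart, ← zero_smul ℝ (1 : A), h2, zero_mul]
  have ha : ω a = ω (a⁺) - ω (a⁻) := by
    rw [← apply_sub_of_mem_charSpace hω, posPart_sub_negPart]
  rw [← posPart_add_negPart a, h1, ha]
  rcases mul_eq_zero.1 h0 with h | h
  · rw [h, zero_add, zero_sub, abs_neg, abs_of_nonneg hn]
  · rw [h, add_zero, sub_zero, abs_of_nonneg hp]

lemma apply_sup_of_mem_charSpace {ω : A → ℝ} (hω : ω ∈ charSpace A) (a b : A) :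
    ω (a ⊔ b) = ω a ⊔ ω b := by
  rw [sup_eq_half_smul_add_add_abs_sub' ℝ a b, sup_eq_half_smul_add_add_abs_sub' ℝ (ω a) (ω b),
    hω.1.2.1, hω.1.1, hω.1.1, apply_abs_of_mem_charSpace hω, apply_sub_of_mem_charSpace hω,
    smul_eq_mul]

lemma abs_le_smul_of_forall_charSpace (hb : ∀ a : A, ∃ c : ℝ, |a| ≤ c • 1) {a : A} {c : ℝ}
    (h : ∀ ω ∈ charSpace A, |ω a| ≤ c) : |a| ≤ c • 1 := by
  rw [← sub_nonneg]
  refine nonneg_of_forall_charSpace hb fun ω hω => ?_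
  rw [apply_sub_of_mem_charSpace hω, hω.1.2.1, hω.1.2.2.1, apply_abs_of_mem_charSpace hω]
  linarith [h ω hω]

lemma eq_of_forall_charSpace (hb : ∀ a : A, ∃ c : ℝ, |a| ≤ c • 1) {a b : A}
    (h : ∀ ω ∈ charSpace A, ω a = ω b) : a = b := by
  apply le_antisymm <;> rw [← sub_nonneg] <;> refine nonneg_of_forall_charSpace hb fun ω hω => ?_
  all_goals rw [apply_sub_of_mem_charSpace hω, h ω hω, sub_self]

lemma apply_inf_of_mem_charSpace {ω : A → ℝ} (hω : ω ∈ charSpace A) (a b : A) :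
    ω (a ⊓ b) = ω a ⊓ ω b := by
  have h1 : ω (a ⊓ b) + ω (a ⊔ b) = ω a + ω b := by
    rw [← hω.1.1, inf_add_sup, hω.1.1]
  rw [apply_sup_of_mem_charSpace hω] at h1
  linarith [inf_add_sup (ω a) (ω b)]

omit [IsArchimedeanFAlgebra A] in
lemma apply_pow_of_mem_charSpace {ω : A → ℝ} (hω : ω ∈ charSpace A) (a : A) (k : ℕ) :
    ω (a ^ k) = ω a ^ k := by
  induction k with
  | zero => simpa using hω.1.2.2.1
  | succ k ih => rw [pow_succ, pow_succ, hω.2, ih]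

omit [IsArchimedeanFAlgebra A] in
lemma continuous_charSpace_apply (b : A) : Continuous fun ω : charSpace A => ω.1 b :=
  (continuous_apply b).comp continuous_subtype_val

/-- `1`-uniform completeness: sequences that are Cauchy relative to the unit converge
relative to the unit. -/
def UnitComplete (A : Type*) [Lattice A] [Ring A] [Algebra ℝ A] : Prop :=
  ∀ u : ℕ → A, (∀ ε : ℝ, 0 < ε → ∃ N, ∀ p q, N ≤ p → N ≤ q → |u p - u q| ≤ ε • 1) →
    ∃ b, ∀ ε : ℝ, 0 < ε → ∃ N, ∀ p, N ≤ p → |u p - b| ≤ ε • 1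

lemma exists_forall_charSpace_eq (hb : ∀ a : A, ∃ c : ℝ, |a| ≤ c • 1) (hA : UnitComplete A)
    {F : charSpace A → ℝ} (hF : Continuous F) : ∃ b : A, ∀ ω : charSpace A, ω.1 b = F ω := by
  have : CompactSpace (charSpace A) := isCompact_iff_compactSpace.1 (isCompact_charSpace hb)
  let S : Subalgebra ℝ C(charSpace A, ℝ) :=
    { carrier := {g | ∃ b : A, ∀ ω : charSpace A, ω.1 b = g ω}
      mul_mem' := by
        rintro g g' ⟨b, h⟩ ⟨b', h'⟩
        exact ⟨b * b', fun ω => by rw [ω.2.2, h, h', ContinuousMap.mul_apply]⟩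
      add_mem' := by
        rintro g g' ⟨b, h⟩ ⟨b', h'⟩
        exact ⟨b + b', fun ω => by rw [ω.2.1.1, h, h', ContinuousMap.add_apply]⟩
      algebraMap_mem' := fun c => ⟨c • 1, fun ω => by
        rw [ω.2.1.2.1, ω.2.1.2.2.1]; simp⟩ }
  have hS : S.SeparatesPoints := by
    intro ω ω' hne
    obtain ⟨b, hne⟩ : ∃ b, ω.1 b ≠ ω'.1 b := by
      by_contra! h
      exact hne (Subtype.ext (funext h))
    exact ⟨_, ⟨⟨fun ω => ω.1 b, continuous_charSpace_apply b⟩, ⟨b, fun _ => rfl⟩, rfl⟩, hne⟩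
  have happrox : ∀ k : ℕ, ∃ b : A, ∀ ω : charSpace A, |ω.1 b - F ω| ≤ 1 / ((k : ℝ) + 1) := by
    intro k
    let G : C(charSpace A, ℝ) := ⟨F, hF⟩
    obtain ⟨g, hg⟩ :=
      ContinuousMap.exists_mem_subalgebra_near_continuousMap_of_separatesPoints S hS G
        (1 / ((k : ℝ) + 1)) (by positivity)
    obtain ⟨b, hgb⟩ := g.2
    refine ⟨b, fun ω => ?_⟩
    have h1 := ((g.1 - G).norm_coe_le_norm ω).trans hg.le
    rw [hgb]
    exact h1
  choose b hbF using happrox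
  have hlim : ∀ ε : ℝ, 0 < ε → ∃ N : ℕ, ∀ p, N ≤ p → 1 / ((p : ℝ) + 1) ≤ ε := by
    intro ε hε
    obtain ⟨N, hN⟩ := exists_nat_one_div_lt hε
    exact ⟨N, fun p hp => (Nat.one_div_le_one_div hp).trans hN.le⟩
  obtain ⟨c, hc⟩ := hA b (by
    intro ε hε
    obtain ⟨N, hN⟩ := hlim (ε / 2) (half_pos hε)
    refine ⟨N, fun p q hp hq => abs_le_smul_of_forall_charSpace hb fun ω hω => ?_⟩
    have h1 := (hbF p ⟨ω, hω⟩).trans (hN p hp)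
    have h2 := (hbF q ⟨ω, hω⟩).trans (hN q hq)
    rw [apply_sub_of_mem_charSpace hω]
    rw [abs_le] at h1 h2 ⊢
    constructor <;> linarith [h1.1, h1.2, h2.1, h2.2])
  refine ⟨c, fun ω => ?_⟩
  refine eq_of_forall_dist_le fun ε hε => ?_
  obtain ⟨N, hN⟩ := hlim (ε / 2) (half_pos hε)
  obtain ⟨M, hM⟩ := hc (ε / 2) (half_pos hε)
  have h1 := (hbF (max N M) ω).trans (hN _ (le_max_left N M))
  have h2 := abs_apply_le_of_mem_stateSpace ω.2.1 (hM _ (le_max_right N M))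
  rw [apply_sub_of_mem_charSpace ω.2] at h2
  rw [Real.dist_eq]
  rw [abs_le] at h1 h2 ⊢
  constructor <;> linarith [h1.1, h1.2, h2.1, h2.2]

lemma abs_mul_le (a b : A) : |a * b| ≤ |a| * |b| := by
  have aux : ∀ a b : A, a * b ≤ |a| * |b| := by
    intro a b
    have h1 := mul_nonneg (sub_nonneg.2 (le_abs_self a)) (neg_le_iff_add_nonneg.1 (neg_le_abs b))
    have h2 := mul_nonneg (neg_le_iff_add_nonneg.1 (neg_le_abs a)) (sub_nonneg.2 (le_abs_self b))
    have h3 : 0 ≤ (2 : ℝ) • (|a| * |b| - a * b) := by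
      convert! add_nonneg h1 h2 using 1
      rw [two_smul]
      noncomm_ring
    have h4 := smul_nonneg (inv_nonneg.2 (zero_le_two (α := ℝ))) h3
    rwa [inv_smul_smul₀ two_ne_zero, sub_nonneg] at h4
  refine abs_le'.2 ⟨aux a b, ?_⟩
  rw [← neg_mul, ← abs_neg a]
  exact aux (-a) b

end IsArchimedeanFAlgebra

/-- The lattice structure on a subalgebra closed under the lattice operations. -/
abbrev Subalgebra.latticeOfClosed {A : Type*} [Lattice A] [Ring A] [Algebra ℝ A]
    (S : Subalgebra ℝ A) (hsup : ∀ ⦃a⦄, a ∈ S → ∀ ⦃b⦄, b ∈ S → a ⊔ b ∈ S)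
    (hinf : ∀ ⦃a⦄, a ∈ S → ∀ ⦃b⦄, b ∈ S → a ⊓ b ∈ S) : Lattice S :=
  Subtype.lattice (fun _ _ ha hb => hsup ha hb) (fun _ _ ha hb => hinf ha hb)

lemma Subalgebra.isArchimedeanFAlgebra {A : Type*} [Lattice A] [Ring A] [Algebra ℝ A]
    [IsOrderedAddMonoid A] [IsOrderedModule ℝ A]
    (hmul : ∀ a b : A, 0 ≤ a → 0 ≤ b → 0 ≤ a * b)
    (harch : ∀ y z : A, 0 ≤ y → (∀ k : ℕ, k • y ≤ z) → y = 0)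
    (S : Subalgebra ℝ A) (hsup : ∀ ⦃a⦄, a ∈ S → ∀ ⦃b⦄, b ∈ S → a ⊔ b ∈ S)
    (hinf : ∀ ⦃a⦄, a ∈ S → ∀ ⦃b⦄, b ∈ S → a ⊓ b ∈ S) (hS : IsFAlgebraSet (S : Set A)) :
    let _ := S.latticeOfClosed hsup hinf
    IsArchimedeanFAlgebra S := by
  let _ := S.latticeOfClosed hsup hinf
  have hone : (0 : A) ≤ 1 := by
    have hp : (1 : A)⁺ ∈ S := hsup S.one_mem S.zero_mem
    have hn : (1 : A)⁻ ∈ S := hsup (S.neg_mem S.one_mem) S.zero_mem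
    have hdisj : ∀ a ∈ S, ∀ b ∈ S, a ⊓ b = 0 → a * b = 0 := by
      intro a ha b hb h
      have ha0 : 0 ≤ a := h ▸ inf_le_left
      have hb0 : 0 ≤ b := h ▸ inf_le_right
      have h1 := (hS a ha b hb b hb h hb0).2
      rw [inf_comm] at h1
      simpa using (hS b hb _ (S.mul_mem ha hb) a ha h1 ha0).1
    have h1 := hdisj _ hp _ hn (posPart_inf_negPart_eq_zero 1)
    have h2 := hdisj _ hn _ hp (by rw [inf_comm]; exact posPart_inf_negPart_eq_zero 1)
    have h3 : (1 : A) = (1 : A)⁺ * (1 : A)⁺ + (1 : A)⁻ * (1 : A)⁻ := by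
      calc (1 : A) = ((1 : A)⁺ - (1 : A)⁻) * ((1 : A)⁺ - (1 : A)⁻) := by
            rw [posPart_sub_negPart, one_mul]
        _ = _ := by rw [sub_mul, mul_sub, mul_sub, h1, h2]; abel
    rw [h3]
    exact add_nonneg (hmul _ _ (posPart_nonneg _) (posPart_nonneg _))
      (hmul _ _ (negPart_nonneg _) (negPart_nonneg _))
  exact
    { add_le_add_left := fun a b h c => add_le_add_left (α := A) h c
      zero_le_one := hone
      mul_le_mul_of_nonneg_left := fun a ha b c h => by
        have := hmul a (c - b) ha (sub_nonneg.2 h)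
        rw [mul_sub, sub_nonneg] at this
        exact this
      mul_le_mul_of_nonneg_right := fun a ha b c h => by
        have := hmul (c - b) a (sub_nonneg.2 h) ha
        rw [sub_mul, sub_nonneg] at this
        exact this
      smul_le_smul_of_nonneg_left := fun c hc a b h => smul_le_smul_of_nonneg_left (β := A) h hc
      smul_le_smul_of_nonneg_right := fun a ha c d h => smul_le_smul_of_nonneg_right (β := A) h ha
      eq_zero_of_nsmul_le := fun y z hy h => Subtype.ext (harch y z hy fun k => h k)
      mul_inf_eq_zero := fun a b z h hz =>
        Subtype.ext (hS a a.2 b b.2 z z.2 (congrArg Subtype.val h) hz).1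
      inf_mul_eq_zero := fun a b z h hz =>
        Subtype.ext (hS a a.2 b b.2 z z.2 (congrArg Subtype.val h) hz).2 }

namespace IsArchimedeanFAlgebra

variable {A : Type*} [Lattice A] [Ring A] [Algebra ℝ A] [IsArchimedeanFAlgebra A]

/-- The subalgebra of elements dominated by a multiple of the identity. -/
def boundedSubalgebra (A : Type*) [Lattice A] [Ring A] [Algebra ℝ A] [IsArchimedeanFAlgebra A] :
    Subalgebra ℝ A where
  carrier := {a | ∃ c : ℝ, 0 ≤ c ∧ |a| ≤ c • 1}
  mul_mem' := by
    rintro a b ⟨c, hc, ha⟩ ⟨d, hd, hb⟩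
    refine ⟨c * d, mul_nonneg hc hd, (abs_mul_le a b).trans ?_⟩
    calc |a| * |b| ≤ (c • 1) * (d • 1) :=
          mul_le_mul ha hb (abs_nonneg b) (smul_nonneg hc zero_le_one)
      _ = (c * d) • 1 := by rw [smul_mul_smul_comm, one_mul]
  add_mem' := by
    rintro a b ⟨c, hc, ha⟩ ⟨d, hd, hb⟩
    refine ⟨c + d, add_nonneg hc hd, (abs_add_le a b).trans ?_⟩
    rw [add_smul]
    exact add_le_add ha hb
  algebraMap_mem' := fun c => ⟨|c|, abs_nonneg c, by
    rw [Algebra.algebraMap_eq_smul_one]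
    refine abs_le'.2 ⟨smul_le_smul_of_nonneg_right (le_abs_self c) zero_le_one, ?_⟩
    rw [← neg_smul]
    exact smul_le_smul_of_nonneg_right (neg_le_abs c) zero_le_one⟩

lemma mem_boundedSubalgebra_of_abs_le {a b : A} (hb : b ∈ boundedSubalgebra A) (h : |a| ≤ |b|) :
    a ∈ boundedSubalgebra A := by
  obtain ⟨c, hc, hb⟩ := hb
  exact ⟨c, hc, h.trans hb⟩

lemma abs_mem_boundedSubalgebra {a : A} (ha : a ∈ boundedSubalgebra A) :
    |a| ∈ boundedSubalgebra A :=
  mem_boundedSubalgebra_of_abs_le ha (abs_abs a).le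

lemma sup_mem_boundedSubalgebra ⦃a : A⦄ (ha : a ∈ boundedSubalgebra A) ⦃b : A⦄
    (hb : b ∈ boundedSubalgebra A) : a ⊔ b ∈ boundedSubalgebra A := by
  rw [sup_eq_half_smul_add_add_abs_sub' ℝ a b]
  exact Subalgebra.smul_mem _ (add_mem (add_mem ha hb)
    (abs_mem_boundedSubalgebra (sub_mem hb ha))) _

lemma inf_mem_boundedSubalgebra ⦃a : A⦄ (ha : a ∈ boundedSubalgebra A) ⦃b : A⦄
    (hb : b ∈ boundedSubalgebra A) : a ⊓ b ∈ boundedSubalgebra A := by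
  have h : a ⊓ b = a + b - (a ⊔ b) := by rw [← inf_add_sup, add_sub_cancel_right]
  rw [h]
  exact sub_mem (add_mem ha hb) (sup_mem_boundedSubalgebra ha hb)

instance : Lattice (boundedSubalgebra A) :=
  (boundedSubalgebra A).latticeOfClosed sup_mem_boundedSubalgebra inf_mem_boundedSubalgebra

instance : IsArchimedeanFAlgebra (boundedSubalgebra A) :=
  (boundedSubalgebra A).isArchimedeanFAlgebra (fun _ _ => mul_nonneg) eq_zero_of_nsmul_le
    sup_mem_boundedSubalgebra inf_mem_boundedSubalgebra fun a _ b _ z _ h hz =>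
      ⟨mul_inf_eq_zero a b z h hz, inf_mul_eq_zero a b z h hz⟩

lemma coe_abs (a : boundedSubalgebra A) : ((|a| : boundedSubalgebra A) : A) = |(a : A)| := rfl

lemma coe_sup (a b : boundedSubalgebra A) :
    ((a ⊔ b : boundedSubalgebra A) : A) = (a : A) ⊔ (b : A) := rfl

lemma boundedSubalgebra_abs_le_smul_one (a : boundedSubalgebra A) :
    ∃ c : ℝ, |a| ≤ c • 1 := by
  obtain ⟨a, c, -, h⟩ := a
  exact ⟨c, h⟩

lemma unitComplete_boundedSubalgebra (hA : UnitComplete A) :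
    UnitComplete (boundedSubalgebra A) := by
  intro u hu
  obtain ⟨b, hb⟩ := hA (fun k => u k) hu
  obtain ⟨N, hN⟩ := hb 1 one_pos
  have h1 : (u N : A) - b ∈ boundedSubalgebra A := ⟨1, zero_le_one, hN N le_rfl⟩
  have h2 : b ∈ boundedSubalgebra A := by
    have := sub_mem (u N).2 h1
    rwa [sub_sub_cancel] at this
  exact ⟨⟨b, h2⟩, hb⟩

lemma smul_sub_inf_smul_one_le {a : A} (ha : 0 ≤ a) {k : ℝ} (hk : 0 ≤ k) :
    k • (a - a ⊓ k • 1) ≤ a * a := by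
  set d : A := a - k • 1 with hd
  have h1 : a - a ⊓ k • 1 = d⁺ := by
    rw [sub_inf, sub_self, sup_comm, posPart_def]
  have h2 : d * d⁺ = d⁺ * d⁺ := by
    have h3 : d⁻ * d⁺ = 0 :=
      mul_eq_zero_of_inf_eq_zero (by rw [inf_comm]; exact posPart_inf_negPart_eq_zero d)
    nth_rw 1 [← posPart_sub_negPart d]
    rw [sub_mul, h3, sub_zero]
  have h4 : 0 ≤ d * d⁺ := h2 ▸ mul_nonneg (posPart_nonneg d) (posPart_nonneg d)
  have h5 : d⁺ ≤ a := sup_le (sub_le_self _ (smul_nonneg hk zero_le_one)) ha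
  rw [hd, sub_mul, smul_mul_assoc, one_mul, ← hd, sub_nonneg] at h4
  rw [h1]
  exact h4.trans (mul_le_mul_of_nonneg_left h5 ha)

lemma inf_smul_one_mem_boundedSubalgebra {a : A} (ha : 0 ≤ a) {k : ℝ} (hk : 0 ≤ k) :
    a ⊓ k • 1 ∈ boundedSubalgebra A :=
  ⟨k, hk, by
    rw [abs_of_nonneg (le_inf ha (smul_nonneg hk zero_le_one))]
    exact inf_le_right⟩

lemma mul_comm_of_mem_boundedSubalgebra {a b : A} (ha : a ∈ boundedSubalgebra A)
    (hb : b ∈ boundedSubalgebra A) : a * b = b * a := by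
  have h : (⟨a, ha⟩ * ⟨b, hb⟩ : boundedSubalgebra A) = ⟨b, hb⟩ * ⟨a, ha⟩ :=
    eq_of_forall_charSpace boundedSubalgebra_abs_le_smul_one fun ω hω => by
      rw [hω.2, hω.2, mul_comm]
  exact congrArg Subtype.val h

lemma mul_comm_of_nonneg {a b : A} (ha : 0 ≤ a) (hb : 0 ≤ b) : a * b = b * a := by
  suffices h : ∀ a b : A, 0 ≤ a → 0 ≤ b → a * b - b * a ≤ 0 from
    le_antisymm (sub_nonpos.1 (h a b ha hb)) (sub_nonpos.1 (h b a hb ha))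
  intro a b ha hb
  refine nonpos_of_le_smul (z := a * a * b + a * (b * b)) fun ε hε => ?_
  have hk : 0 ≤ ε⁻¹ := inv_nonneg.2 hε.le
  have hle : ∀ c : A, 0 ≤ c → c - c ⊓ ε⁻¹ • 1 ≤ ε • (c * c) := fun c hc => by
    have := smul_le_smul_of_nonneg_left (smul_sub_inf_smul_one_le hc hk) hε.le
    rwa [smul_inv_smul₀ hε.ne'] at this
  have h1 := hle a ha
  have h2 := hle b hb
  have hab := mul_comm_of_mem_boundedSubalgebra (inf_smul_one_mem_boundedSubalgebra ha hk)
    (inf_smul_one_mem_boundedSubalgebra hb hk)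
  have ha1 : a ⊓ ε⁻¹ • 1 ≤ a := inf_le_left
  have hb1 : b ⊓ ε⁻¹ • 1 ≤ b := inf_le_left
  have ha0 : 0 ≤ a ⊓ ε⁻¹ • 1 := le_inf ha (smul_nonneg hk zero_le_one)
  have hb0 : 0 ≤ b ⊓ ε⁻¹ • 1 := le_inf hb (smul_nonneg hk zero_le_one)
  set a' := a ⊓ ε⁻¹ • 1
  set b' := b ⊓ ε⁻¹ • 1
  calc a * b - b * a ≤ a * b - b' * a' := sub_le_sub_left (mul_le_mul hb1 ha1 ha0 hb) _
    _ = (a - a') * b + a' * (b - b') := by rw [← hab]; noncomm_ring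
    _ ≤ ε • (a * a) * b + a * (ε • (b * b)) :=
        add_le_add (mul_le_mul_of_nonneg_right h1 hb) (mul_le_mul ha1 h2 (sub_nonneg.2 hb1) ha)
    _ = ε • (a * a * b + a * (b * b)) := by
        rw [smul_mul_assoc, mul_smul_comm, ← smul_add]

protected lemma mul_comm (a b : A) : a * b = b * a := by
  have h := fun {c d : A} => mul_comm_of_nonneg (a := c) (b := d)
  rw [← posPart_sub_negPart a, ← posPart_sub_negPart b, sub_mul, mul_sub, mul_sub, sub_mul,
    mul_sub, mul_sub, h (posPart_nonneg a) (posPart_nonneg b),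
    h (posPart_nonneg a) (negPart_nonneg b), h (negPart_nonneg a) (posPart_nonneg b),
    h (negPart_nonneg a) (negPart_nonneg b)]
  abel

lemma exists_mul_eq_one (hA : UnitComplete A) {s : A} (hs : 1 ≤ s) :
    ∃ u : A, 0 ≤ u ∧ u ≤ 1 ∧ s * u = 1 := by
  have hs0 : 0 ≤ s := zero_le_one.trans hs
  have hk : ∀ k : ℕ, 0 ≤ (k : ℝ) + 1 := fun k => by positivity
  let S : ℕ → boundedSubalgebra A := fun k =>
    ⟨s ⊓ ((k : ℝ) + 1) • 1, inf_smul_one_mem_boundedSubalgebra hs0 (hk k)⟩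
  have hS1 : ∀ k, 1 ≤ S k := fun k => le_inf hs (by
    calc (1 : A) = (1 : ℝ) • 1 := (one_smul _ _).symm
      _ ≤ _ := smul_le_smul_of_nonneg_right (by linarith [k.cast_nonneg (α := ℝ)]) zero_le_one)
  have hbB := boundedSubalgebra_abs_le_smul_one (A := A)
  have hωS : ∀ k, ∀ ω ∈ charSpace (boundedSubalgebra A), 1 ≤ ω (S k) := fun k ω hω => by
    have := hω.1.2.2.2 _ (sub_nonneg.2 (hS1 k))
    rw [apply_sub_of_mem_charSpace hω, hω.1.2.2.1] at this
    linarith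
  have hex : ∀ k, ∃ v : boundedSubalgebra A, ∀ ω : charSpace (boundedSubalgebra A),
      ω.1 v = (ω.1 (S k))⁻¹ := fun k =>
    exists_forall_charSpace_eq hbB (unitComplete_boundedSubalgebra hA)
      ((continuous_charSpace_apply (S k)).inv₀ fun ω => by linarith [hωS k ω.1 ω.2])
  choose v hv' using hex
  have hv : ∀ k, ∀ ω ∈ charSpace (boundedSubalgebra A), ω (v k) = (ω (S k))⁻¹ :=
    fun k ω hω => hv' k ⟨ω, hω⟩
  have hSv : ∀ k, S k * v k = 1 := fun k => eq_of_forall_charSpace hbB fun ω hω => by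
    rw [hω.2, hv k ω hω, hω.1.2.2.1]
    exact mul_inv_cancel₀ (by linarith [hωS k ω hω])
  have hv0 : ∀ k, 0 ≤ v k := fun k => nonneg_of_forall_charSpace hbB fun ω hω => by
    rw [hv k ω hω]
    exact inv_nonneg.2 (by linarith [hωS k ω hω])
  have hv1 : ∀ k, v k ≤ 1 := fun k => by
    rw [← sub_nonneg]
    refine nonneg_of_forall_charSpace hbB fun ω hω => ?_
    rw [apply_sub_of_mem_charSpace hω, hω.1.2.2.1, hv k ω hω]
    exact sub_nonneg.2 (inv_le_one_of_one_le₀ (hωS k ω hω))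
  have hcauchy : ∀ N p q : ℕ, N ≤ p → N ≤ q → |v p - v q| ≤ (1 / ((N : ℝ) + 1)) • 1 := by
    intro N
    have aux : ∀ p q : ℕ, N ≤ p → p ≤ q → |v p - v q| ≤ (1 / ((N : ℝ) + 1)) • 1 := by
      intro p q hNp hpq
      refine abs_le_smul_of_forall_charSpace hbB fun ω hω => ?_
      rw [apply_sub_of_mem_charSpace hω, hv p ω hω, hv q ω hω]
      have hSpq : S p = S q ⊓ ((p : ℝ) + 1) • 1 := by
        refine Subtype.ext ?_
        change s ⊓ ((p : ℝ) + 1) • (1 : A) = (s ⊓ ((q : ℝ) + 1) • (1 : A)) ⊓ ((p : ℝ) + 1) • (1 : A)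
        have hle : ((p : ℝ) + 1) • (1 : A) ≤ ((q : ℝ) + 1) • (1 : A) :=
          smul_le_smul_of_nonneg_right (by exact_mod_cast Nat.add_le_add_right hpq 1)
            zero_le_one
        rw [inf_assoc, inf_eq_right.2 hle]
      have hωp : ω (S p) = min (ω (S q)) ((p : ℝ) + 1) := by
        conv_lhs => rw [hSpq]
        rw [apply_inf_of_mem_charSpace hω, hω.1.2.1, hω.1.2.2.1, mul_one]
      have hNp' : (N : ℝ) + 1 ≤ p + 1 := by exact_mod_cast Nat.add_le_add_right hNp 1
      have hN0 : (0 : ℝ) < (N : ℝ) + 1 := by positivity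
      have hq1 := hωS q ω hω
      change |(ω (S p))⁻¹ - (ω (S q))⁻¹| ≤ _
      rcases le_total (ω (S q)) ((p : ℝ) + 1) with h | h
      · rw [hωp, min_eq_left h, sub_self, abs_zero]
        positivity
      · rw [hωp, min_eq_right h, one_div]
        have e1 : ((p : ℝ) + 1)⁻¹ ≤ ((N : ℝ) + 1)⁻¹ := inv_anti₀ hN0 hNp'
        have e2 : (ω (S q))⁻¹ ≤ ((p : ℝ) + 1)⁻¹ := inv_anti₀ (by positivity) h
        have e3 : 0 ≤ (ω (S q))⁻¹ := by positivity
        rw [abs_of_nonneg (by linarith)]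
        linarith
    intro p q hp hq
    rcases le_total p q with h | h
    · exact aux p q hp h
    · rw [abs_sub_comm]
      exact aux q p hq h
  have hlim : ∀ ε : ℝ, 0 < ε → ∃ N : ℕ, 1 / ((N : ℝ) + 1) ≤ ε := fun ε hε =>
    (exists_nat_one_div_lt hε).imp fun _ h => h.le
  obtain ⟨u, hu⟩ := hA (fun k => v k) (by
    intro ε hε
    obtain ⟨N, hN⟩ := hlim ε hε
    exact ⟨N, fun p q hp hq => (hcauchy N p q hp hq : |(v p : A) - v q| ≤ _).trans
      (smul_le_smul_of_nonneg_right hN zero_le_one)⟩)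
  have hu0 : 0 ≤ u := by
    refine neg_nonpos.1 (nonpos_of_le_smul (z := (1 : A)) fun ε hε => ?_)
    obtain ⟨N, hN⟩ := hu ε hε
    have h1 : (0 : A) ≤ v N := hv0 N
    exact (neg_le_sub_iff_le_add.2 (by simpa using h1)).trans
      ((le_abs_self _).trans (hN N le_rfl))
  have hsu : s * u = 1 := by
    refine eq_of_abs_sub_le_smul (z := s + s * s) fun ε hε => ?_
    obtain ⟨N, hN⟩ := hu ε hε
    obtain ⟨M, hM⟩ := hlim ε hε
    set p := max N M
    have hpM : 1 / ((p : ℝ) + 1) ≤ ε := (Nat.one_div_le_one_div (le_max_right N M)).trans hM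
    have h1 : |u - v p| ≤ ε • 1 := by rw [abs_sub_comm]; exact hN p (le_max_left N M)
    have h2 : s - S p ≤ ε • (s * s) := by
      have h3 := smul_le_smul_of_nonneg_left (smul_sub_inf_smul_one_le hs0 (hk p))
        (inv_nonneg.2 (hk p))
      rw [inv_smul_smul₀ (by positivity), ← one_div] at h3
      exact h3.trans (smul_le_smul_of_nonneg_right hpM (mul_nonneg hs0 hs0))
    have h3 : (S p : A) * v p = 1 := congrArg Subtype.val (hSv p)
    have h4 : (0 : A) ≤ s - S p := sub_nonneg.2 inf_le_left
    have hvp0 : (0 : A) ≤ v p := hv0 p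
    have hvp1 : (v p : A) ≤ 1 := hv1 p
    calc |s * u - 1| = |s * (u - v p) + (s - S p) * v p| := by
          congr 1; rw [mul_sub, sub_mul, h3]; abel
      _ ≤ |s * (u - v p)| + |(s - S p) * v p| := abs_add_le _ _
      _ = s * |u - v p| + (s - S p) * v p := by
          rw [abs_mul_of_nonneg hs0, abs_of_nonneg (mul_nonneg h4 hvp0)]
      _ ≤ s * (ε • 1) + ε • (s * s) * 1 :=
          add_le_add (mul_le_mul_of_nonneg_left h1 hs0)
            (mul_le_mul h2 hvp1 hvp0 (h4.trans h2))
      _ = ε • (s + s * s) := by rw [mul_smul_comm, mul_one, mul_one, smul_add]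
  refine ⟨u, hu0, ?_, hsu⟩
  calc u = 1 * u := (one_mul u).symm
    _ ≤ s * u := mul_le_mul_of_nonneg_right hs hu0
    _ = 1 := hsu

section FunctionalCalculus

variable {n : ℕ} {U : boundedSubalgebra A} {V : Fin n → boundedSubalgebra A}

/-- `z = g (V / U)`, in the sense that for some `N` the element `U ^ N * z` is bounded and is
represented on the character space by `U ^ N * g (V / U)`. -/
def IsCalculus (U : boundedSubalgebra A) (V : Fin n → boundedSubalgebra A) (N : ℕ)
    (g : (Fin n → ℝ) → ℝ) (z : A) : Prop :=
  ∃ b : boundedSubalgebra A, (b : A) = (U : A) ^ N * z ∧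
    ∀ ω ∈ charSpace (boundedSubalgebra A), ω b = ω U ^ N * g fun i => ω (V i) / ω U

lemma IsCalculus.add_right {N : ℕ} {g : (Fin n → ℝ) → ℝ} {z : A} (h : IsCalculus U V N g z)
    (M : ℕ) : IsCalculus U V (M + N) g z := by
  obtain ⟨b, hb, hω⟩ := h
  refine ⟨U ^ M * b, ?_, fun ω h => ?_⟩
  · rw [Subalgebra.coe_mul, Subalgebra.coe_pow, hb, pow_add, mul_assoc]
  · rw [h.2, apply_pow_of_mem_charSpace h, hω ω h, pow_add, mul_assoc]

lemma IsCalculus.unique {s : A} (hs : s * (U : A) = 1) {N N' : ℕ} {g : (Fin n → ℝ) → ℝ} {z z' : A}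
    (h : IsCalculus U V N g z) (h' : IsCalculus U V N' g z') : z = z' := by
  obtain ⟨b, hb, hω⟩ := h.add_right N'
  obtain ⟨b', hb', hω'⟩ := h'.add_right N
  rw [add_comm N' N] at hb hω
  have hbb : b = b' := eq_of_forall_charSpace boundedSubalgebra_abs_le_smul_one fun ω h => by
    rw [hω ω h, hω' ω h]
  have hcancel : s ^ (N + N') * (U : A) ^ (N + N') = 1 := by
    rw [← Commute.mul_pow (IsArchimedeanFAlgebra.mul_comm _ _), hs, one_pow]
  rw [hbb, hb'] at hb
  have := congrArg (s ^ (N + N') * ·) hb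
  simp only [← mul_assoc, hcancel, one_mul] at this
  exact this.symm

lemma IsCalculus.add {N N' : ℕ} {g g' : (Fin n → ℝ) → ℝ} {z z' : A}
    (h : IsCalculus U V N g z) (h' : IsCalculus U V N' g' z') :
    IsCalculus U V (N + N') (g + g') (z + z') := by
  obtain ⟨b, hb, hω⟩ := h.add_right N'
  obtain ⟨b', hb', hω'⟩ := h'.add_right N
  rw [add_comm N' N] at hb hω
  refine ⟨b + b', ?_, fun ω h => ?_⟩
  · rw [Subalgebra.coe_add, hb, hb', mul_add]
  · rw [h.1.1, hω ω h, hω' ω h, Pi.add_apply, mul_add]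

lemma IsCalculus.smul {N : ℕ} {g : (Fin n → ℝ) → ℝ} {z : A}
    (h : IsCalculus U V N g z) (c : ℝ) : IsCalculus U V N (c • g) (c • z) := by
  obtain ⟨b, hb, hω⟩ := h
  refine ⟨c • b, ?_, fun ω h => ?_⟩
  · rw [Subalgebra.coe_smul, hb, mul_smul_comm]
  · rw [h.1.2.1, hω ω h, Pi.smul_apply, smul_eq_mul, mul_left_comm]

lemma IsCalculus.sup (hU : 0 ≤ U) {N N' : ℕ} {g g' : (Fin n → ℝ) → ℝ} {z z' : A}
    (h : IsCalculus U V N g z) (h' : IsCalculus U V N' g' z') :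
    IsCalculus U V (N + N') (g ⊔ g') (z ⊔ z') := by
  obtain ⟨b, hb, hω⟩ := h.add_right N'
  obtain ⟨b', hb', hω'⟩ := h'.add_right N
  rw [add_comm N' N] at hb hω
  have hU' : (0 : A) ≤ U := hU
  refine ⟨b ⊔ b', ?_, fun ω h => ?_⟩
  · rw [coe_sup, hb, hb', mul_sup_of_nonneg (pow_nonneg hU' _)]
  · rw [apply_sup_of_mem_charSpace h, hω ω h, hω' ω h, Pi.sup_apply,
      mul_max_of_nonneg _ _ (pow_nonneg (h.1.2.2.2 U hU) _)]

lemma IsCalculus.mul {N N' : ℕ} {g g' : (Fin n → ℝ) → ℝ} {z z' : A}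
    (h : IsCalculus U V N g z) (h' : IsCalculus U V N' g' z') :
    IsCalculus U V (N + N') (g * g') (z * z') := by
  obtain ⟨b, hb, hω⟩ := h
  obtain ⟨b', hb', hω'⟩ := h'
  refine ⟨b * b', ?_, fun ω h => ?_⟩
  · rw [Subalgebra.coe_mul, hb, hb', pow_add, mul_assoc, mul_assoc, ← mul_assoc z,
      IsArchimedeanFAlgebra.mul_comm z, mul_assoc]
  · rw [h.2, hω ω h, hω' ω h, Pi.mul_apply, pow_add]; ring

lemma isCalculus_one : IsCalculus U V 0 1 (1 : A) :=
  ⟨1, by simp, fun ω h => by rw [h.1.2.2.1]; simp⟩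

lemma isCalculus_coord {i : Fin n} {z : A} (hz : (V i : A) = U * z) :
    IsCalculus U V 2 (fun t => t i) z := by
  refine ⟨U * V i, ?_, fun ω h => ?_⟩
  · rw [Subalgebra.coe_mul, hz, pow_two, mul_assoc]
  · rw [h.2]
    rcases eq_or_ne (ω U) 0 with h0 | h0
    · simp [h0]
    · field_simp

lemma exists_isCalculus (hA : UnitComplete A) {s : A} (hs : s * (U : A) = 1) (hU : 0 ≤ U)
    (hUV : U + ∑ i, |V i| = 1) {g : (Fin n → ℝ) → ℝ} (hg : PolyGrowth n g) :
    ∃ N, ∃ z : A, IsCalculus U V N g z := by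
  obtain ⟨hgc, M, N, hM, hgM⟩ := hg
  let F : charSpace (boundedSubalgebra A) → ℝ := fun ω =>
    ω.1 U ^ (N + 1) * g fun i => ω.1 (V i) / ω.1 U
  have hU0 : ∀ ω : charSpace (boundedSubalgebra A), 0 ≤ ω.1 U := fun ω => ω.2.1.2.2.2 U hU
  have hsum : ∀ ω : charSpace (boundedSubalgebra A), ω.1 U + ∑ i, |ω.1 (V i)| = 1 := by
    intro ω
    have h1 : ∀ T : Finset (Fin n), ω.1 (∑ i ∈ T, |V i|) = ∑ i ∈ T, |ω.1 (V i)| := by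
      intro T
      induction T using Finset.induction_on with
      | empty =>
        have := ω.2.1.2.1 0 0
        simpa using this
      | insert a T ha ih =>
        rw [Finset.sum_insert ha, Finset.sum_insert ha, ω.2.1.1, ih,
          apply_abs_of_mem_charSpace ω.2]
    rw [← h1, ← ω.2.1.1, hUV, ω.2.1.2.2.1]
  have hFle : ∀ ω, |F ω| ≤ M * ω.1 U := by
    intro ω
    rcases (hU0 ω).eq_or_lt with h0 | h0
    · simp [F, ← h0]
    · have h1 : ω.1 U * (1 + ∑ i, |ω.1 (V i) / ω.1 U|) = 1 := by
        rw [mul_add, Finset.mul_sum, mul_one, ← hsum ω]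
        congr 1
        refine Finset.sum_congr rfl fun i _ => ?_
        rw [abs_div, abs_of_pos h0, mul_div_cancel₀ _ h0.ne']
      calc |F ω| = ω.1 U ^ (N + 1) * |g fun i => ω.1 (V i) / ω.1 U| := by
            rw [abs_mul, abs_of_nonneg (pow_nonneg h0.le _)]
        _ ≤ ω.1 U ^ (N + 1) * (M * (1 + ∑ i, |ω.1 (V i) / ω.1 U|) ^ N) := by
            gcongr
            exact hgM _
        _ = M * ω.1 U * (ω.1 U * (1 + ∑ i, |ω.1 (V i) / ω.1 U|)) ^ N := by
            rw [mul_pow]; ring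
        _ = M * ω.1 U := by rw [h1, one_pow, mul_one]
  have hF : Continuous F := by
    refine continuous_iff_continuousAt.2 fun ω₀ => ?_
    have hUc := continuous_charSpace_apply U
    rcases (hU0 ω₀).eq_or_lt with h0 | h0
    · have h1 : F ω₀ = 0 := by simp [F, ← h0]
      rw [ContinuousAt, h1]
      refine squeeze_zero_norm hFle ?_
      have h2 := (hUc.const_mul M).tendsto ω₀
      rwa [← h0, mul_zero] at h2
    · refine (hUc.pow _).continuousAt.mul (hgc.continuousAt.comp ?_)
      exact continuousAt_pi.2 fun i =>
        (continuous_charSpace_apply (V i)).continuousAt.div hUc.continuousAt h0.ne'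
  obtain ⟨b, hb⟩ := exists_forall_charSpace_eq boundedSubalgebra_abs_le_smul_one
    (unitComplete_boundedSubalgebra hA) hF
  refine ⟨N + 1, s ^ (N + 1) * b, b, ?_, fun ω h => hb ⟨ω, h⟩⟩
  rw [← mul_assoc, ← Commute.mul_pow (IsArchimedeanFAlgebra.mul_comm _ _),
    IsArchimedeanFAlgebra.mul_comm (U : A) s, hs, one_pow, one_mul]

end FunctionalCalculus

theorem exists_isLatAlgHom (hA : UnitComplete A) {n : ℕ} (x : Fin n → A) :
    ∃ Ψ : ∀ f : (Fin n → ℝ) → ℝ, PolyGrowth n f → A, IsLatAlgHom (PolyGrowth n) Ψ ∧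
      (∀ h1 : PolyGrowth n 1, Ψ 1 h1 = 1) ∧
      ∀ (i : Fin n) (hi : PolyGrowth n fun t => t i), Ψ (fun t => t i) hi = x i := by
  set s : A := 1 + ∑ i, |x i| with hs
  have hsum : ∀ i, |x i| ≤ s := fun i =>
    (Finset.single_le_sum (f := fun i => |x i|) (fun i _ => abs_nonneg (x i))
      (Finset.mem_univ i)).trans (le_add_of_nonneg_left zero_le_one)
  obtain ⟨u, hu0, hu1, hsu⟩ := exists_mul_eq_one hA (s := s)
    (le_add_of_nonneg_right (Finset.sum_nonneg fun i _ => abs_nonneg (x i)))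
  have hus : u * s = 1 := by rw [IsArchimedeanFAlgebra.mul_comm, hsu]
  let U : boundedSubalgebra A := ⟨u, 1, zero_le_one, by rwa [abs_of_nonneg hu0, one_smul]⟩
  let V : Fin n → boundedSubalgebra A := fun i => ⟨u * x i, 1, zero_le_one, by
    rw [abs_mul_of_nonneg hu0, one_smul, ← hus]
    exact mul_le_mul_of_nonneg_left (hsum i) hu0⟩
  have hU : 0 ≤ U := hu0
  have hUV : U + ∑ i, |V i| = 1 := by
    refine Subtype.ext ?_
    rw [Subalgebra.coe_add, AddSubmonoidClass.coe_finsetSum, Subalgebra.coe_one, ← hus, hs,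
      mul_add, mul_one, Finset.mul_sum]
    simp only [coe_abs, V, abs_mul_of_nonneg hu0, U]
  choose N Ψ hΨ using fun (f : (Fin n → ℝ) → ℝ) (hf : PolyGrowth n f) =>
    exists_isCalculus hA (U := U) (V := V) hsu hU hUV hf
  refine ⟨Ψ, ⟨⟨fun f g hf hg hfg => ?_, fun c f hf hcf => ?_, fun f g hf hg hfg => ?_⟩,
    fun f g hf hg hfg => ?_⟩, fun h1 => ?_, fun i hi => ?_⟩
  · exact (hΨ _ hfg).unique hsu ((hΨ f hf).add (hΨ g hg))
  · exact (hΨ _ hcf).unique hsu ((hΨ f hf).smul c)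
  · exact (hΨ _ hfg).unique hsu ((hΨ f hf).sup hU (hΨ g hg))
  · exact (hΨ _ hfg).unique hsu ((hΨ f hf).mul (hΨ g hg))
  · exact (hΨ _ h1).unique hsu isCalculus_one
  · exact (hΨ _ hi).unique hsu (isCalculus_coord rfl)

end IsArchimedeanFAlgebra

section RegNorm

variable {X : Type*} [Lattice X] [AddCommGroup X] [Module ℝ X]

lemma regNorm_le_of_abs_le_smul {W x : X} {ε : ℝ} (hε : 0 ≤ ε) (h : |x| ≤ ε • W) :
    regNorm W x ≤ ε :=
  csInf_le ⟨0, fun _ hc => hc.1⟩ ⟨hε, h⟩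

variable [IsOrderedAddMonoid X]

lemma abs_le_smul_of_regNorm_lt [IsOrderedModule ℝ X] {W x : X} (hW : 0 ≤ W)
    (hx : x ∈ idealSet W) {ε : ℝ} (h : regNorm W x < ε) : |x| ≤ ε • W := by
  obtain ⟨c, hc, hcε⟩ := exists_lt_of_csInf_lt hx h
  exact hc.2.trans (smul_le_smul_of_nonneg_right hcε.le hW)

lemma abs_add_le_add_smul {W x y : X} {a b : ℝ} (hx : |x| ≤ a • W) (hy : |y| ≤ b • W) :
    |x + y| ≤ (a + b) • W := by
  rw [add_smul]
  exact (abs_add_le x y).trans (add_le_add hx hy)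

lemma sub_mem_idealSet {W x y : X} (hx : x ∈ idealSet W) (hy : y ∈ idealSet W) :
    x - y ∈ idealSet W := by
  obtain ⟨a, ha, hxa⟩ := hx
  obtain ⟨b, hb, hyb⟩ := hy
  refine ⟨a + b, add_nonneg ha hb, ?_⟩
  rw [sub_eq_add_neg]
  exact abs_add_le_add_smul hxa (by rwa [abs_neg])

end RegNorm

lemma le_fold_sup {α ι : Type*} [SemilatticeSup α] (b : α) (g : ι → α) (s : Finset ι) :
    b ≤ s.fold (fun a c : α => a ⊔ c) b g := by
  classical
  induction s using Finset.induction_on with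
  | empty => simp
  | insert i s hi ih =>
    rw [Finset.fold_insert hi]
    exact ih.trans le_sup_right

theorem exists_isLatAlgHom_of_normComplete {X : Type*} [Lattice X] [Ring X] [Algebra ℝ X]
    [IsOrderedAddMonoid X] [IsOrderedModule ℝ X]
    (hmul : ∀ a b : X, 0 ≤ a → 0 ≤ b → 0 ≤ a * b)
    (harch : ∀ y z : X, 0 ≤ y → (∀ k : ℕ, k • y ≤ z) → y = 0)
    {f : X} (hf : 1 ≤ f) {Y : Set X} (hY : IsFSubalgebra Y) (h1 : (1 : X) ∈ Y)
    (hc : NormComplete f (Y ∩ idealSet f)) {n : ℕ} {x : Fin n → X} (hx : ∀ i, x i ∈ Y) :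
    ∃ Ψ : ∀ f : (Fin n → ℝ) → ℝ, PolyGrowth n f → X,
      IsLatAlgHom (PolyGrowth n) Ψ ∧
      (∀ h1 : PolyGrowth n 1, Ψ 1 h1 = 1) ∧
      (∀ (i : Fin n) (hi : PolyGrowth n fun t => t i), Ψ (fun t => t i) hi = x i) := by
  obtain ⟨⟨⟨-, hadd, hsmul, hneg, hsup, hinf⟩, hmulY⟩, hfY⟩ := hY
  let S : Subalgebra ℝ X :=
    { carrier := Y
      mul_mem' := fun ha hb => hmulY _ ha _ hb
      add_mem' := fun ha hb => hadd _ ha _ hb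
      algebraMap_mem' := fun c => by
        rw [Algebra.algebraMap_eq_smul_one]
        exact hsmul c 1 h1 }
  have hsupS : ∀ ⦃a⦄, a ∈ S → ∀ ⦃b⦄, b ∈ S → a ⊔ b ∈ S := fun a ha b hb => hsup a ha b hb
  have hinfS : ∀ ⦃a⦄, a ∈ S → ∀ ⦃b⦄, b ∈ S → a ⊓ b ∈ S := fun a ha b hb => hinf a ha b hb
  let _ := S.latticeOfClosed hsupS hinfS
  have _ : IsArchimedeanFAlgebra S := S.isArchimedeanFAlgebra hmul harch hsupS hinfS hfY
  have hone : (0 : X) ≤ 1 := (zero_le_one : (0 : S) ≤ 1)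
  have hf0 : 0 ≤ f := hone.trans hf
  have hS : IsArchimedeanFAlgebra.UnitComplete S := by
    intro u hu
    obtain ⟨N₀, hN₀⟩ := hu 1 one_pos
    obtain ⟨b, hb, hlim⟩ := hc (fun k => (u (N₀ + k) : X) - u N₀)
      (fun k => ⟨S.sub_mem (u (N₀ + k)).2 (u N₀).2, 1, zero_le_one,
        (show |(u (N₀ + k) : X) - u N₀| ≤ (1 : ℝ) • 1 from
          hN₀ _ _ (Nat.le_add_right _ _) le_rfl).trans
          (smul_le_smul_of_nonneg_left hf zero_le_one)⟩)
      (fun ε hε => by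
        obtain ⟨N, hN⟩ := hu (ε / 2) (half_pos hε)
        refine ⟨N, fun p q hp hq => (regNorm_le_of_abs_le_smul (half_pos hε).le ?_).trans_lt
          (half_lt_self hε)⟩
        rw [sub_sub_sub_cancel_right]
        exact (show |(u (N₀ + p) : X) - u (N₀ + q)| ≤ (ε / 2) • 1 from
          hN _ _ (hp.trans (Nat.le_add_left _ _)) (hq.trans (Nat.le_add_left _ _))).trans
          (smul_le_smul_of_nonneg_left hf (half_pos hε).le))
    refine ⟨⟨b, hb.1⟩ + u N₀, fun ε hε => ?_⟩
    obtain ⟨N, hN⟩ := hu ε hε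
    refine ⟨N, fun p hp => ?_⟩
    change |(u p : X) - (b + u N₀)| ≤ ε • (1 : X)
    refine sub_nonpos.1 (nonpos_of_forall_le_smul harch (z := f) fun δ hδ => ?_)
    obtain ⟨M, hM⟩ := hlim δ hδ
    have hmem : (u (N₀ + max M N) : X) - u N₀ - b ∈ idealSet f := by
      refine sub_mem_idealSet ⟨1, zero_le_one, ?_⟩ hb.2
      exact (show |(u (N₀ + max M N) : X) - u N₀| ≤ (1 : ℝ) • 1 from
          hN₀ _ _ (Nat.le_add_right _ _) le_rfl).trans
          (smul_le_smul_of_nonneg_left hf zero_le_one)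
    have h2 := abs_le_smul_of_regNorm_lt hf0 hmem (hM _ (le_max_left _ _))
    have h3 : |(u p : X) - u (N₀ + max M N)| ≤ ε • (1 : X) :=
      hN _ _ hp ((le_max_right _ _).trans (Nat.le_add_left _ _))
    have h4 : (u p : X) - (b + u N₀) =
        (u p - u (N₀ + max M N)) + (u (N₀ + max M N) - u N₀ - b) := by abel
    rw [h4, sub_le_iff_le_add']
    exact (abs_add_le _ _).trans (add_le_add h3 h2)
  obtain ⟨Φ, hΦ, hΦ1, hΦx⟩ :=
    IsArchimedeanFAlgebra.exists_isLatAlgHom hS (fun i => (⟨x i, hx i⟩ : S))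
  exact ⟨fun g hg => (Φ g hg : X),
    ⟨⟨fun f g hf hg hfg => congrArg Subtype.val (hΦ.1.1 f g hf hg hfg),
      fun c f hf hcf => congrArg Subtype.val (hΦ.1.2.1 c f hf hcf),
      fun f g hf hg hfg => congrArg Subtype.val (hΦ.1.2.2 f g hf hg hfg)⟩,
      fun f g hf hg hfg => congrArg Subtype.val (hΦ.2 f g hf hg hfg)⟩,
    fun h1 => congrArg Subtype.val (hΦ1 h1), fun i hi => congrArg Subtype.val (hΦx i hi)⟩

section PolyGrowth

variable {n : ℕ} {f g : (Fin n → ℝ) → ℝ}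

lemma one_le_one_add_sum_abs (t : Fin n → ℝ) : 1 ≤ 1 + ∑ i : Fin n, |t i| :=
  le_add_of_nonneg_right (Finset.sum_nonneg fun i _ => abs_nonneg (t i))

lemma PolyGrowth.of_abs_le (hf : PolyGrowth n f) (hg : Continuous g)
    (h : ∀ t, |g t| ≤ |f t|) : PolyGrowth n g := by
  obtain ⟨-, M, N, hM, hfM⟩ := hf
  exact ⟨hg, M, N, hM, fun t => (h t).trans (hfM t)⟩

lemma PolyGrowth.add (hf : PolyGrowth n f) (hg : PolyGrowth n g) : PolyGrowth n (f + g) := by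
  obtain ⟨hfc, M, N, hM, hfM⟩ := hf
  obtain ⟨hgc, M', N', hM', hgM⟩ := hg
  refine ⟨hfc.add hgc, M + M', N + N', add_nonneg hM hM', fun t => ?_⟩
  have h1 := one_le_one_add_sum_abs t
  have h2 : M * (1 + ∑ i : Fin n, |t i|) ^ N ≤ M * (1 + ∑ i : Fin n, |t i|) ^ (N + N') :=
    mul_le_mul_of_nonneg_left (pow_le_pow_right₀ h1 (Nat.le_add_right _ _)) hM
  have h3 : M' * (1 + ∑ i : Fin n, |t i|) ^ N' ≤ M' * (1 + ∑ i : Fin n, |t i|) ^ (N + N') :=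
    mul_le_mul_of_nonneg_left (pow_le_pow_right₀ h1 (Nat.le_add_left _ _)) hM'
  rw [add_mul]
  exact (abs_add_le _ _).trans (add_le_add ((hfM t).trans h2) ((hgM t).trans h3))

lemma PolyGrowth.mul (hf : PolyGrowth n f) (hg : PolyGrowth n g) : PolyGrowth n (f * g) := by
  obtain ⟨hfc, M, N, hM, hfM⟩ := hf
  obtain ⟨hgc, M', N', hM', hgM⟩ := hg
  refine ⟨hfc.mul hgc, M * M', N + N', mul_nonneg hM hM', fun t => ?_⟩
  rw [Pi.mul_apply, abs_mul, pow_add, mul_mul_mul_comm]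
  exact mul_le_mul (hfM t) (hgM t) (abs_nonneg _) ((abs_nonneg _).trans (hfM t))

lemma polyGrowth_const (c : ℝ) : PolyGrowth n fun _ => c :=
  ⟨continuous_const, |c|, 0, abs_nonneg c, fun _ => by simp⟩

lemma polyGrowth_one : PolyGrowth n 1 := polyGrowth_const 1

lemma polyGrowth_zero : PolyGrowth n 0 := polyGrowth_const 0

lemma polyGrowth_coord (i : Fin n) : PolyGrowth n fun t => t i := by
  refine ⟨continuous_apply i, 1, 1, zero_le_one, fun t => ?_⟩
  rw [one_mul, pow_one]
  exact (Finset.single_le_sum (f := fun i => |t i|) (fun i _ => abs_nonneg (t i))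
    (Finset.mem_univ i)).trans (le_add_of_nonneg_left zero_le_one)

lemma PolyGrowth.smul (hf : PolyGrowth n f) (c : ℝ) : PolyGrowth n (c • f) :=
  (polyGrowth_const c).mul hf

lemma PolyGrowth.neg (hf : PolyGrowth n f) : PolyGrowth n (-f) :=
  hf.of_abs_le hf.1.neg fun t => (abs_neg (f t)).le

lemma PolyGrowth.sub (hf : PolyGrowth n f) (hg : PolyGrowth n g) : PolyGrowth n (f - g) := by
  rw [sub_eq_add_neg]
  exact hf.add hg.neg

lemma PolyGrowth.abs (hf : PolyGrowth n f) : PolyGrowth n |f| :=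
  hf.of_abs_le hf.1.abs fun t => (abs_abs (f t)).le

lemma PolyGrowth.sup (hf : PolyGrowth n f) (hg : PolyGrowth n g) : PolyGrowth n (f ⊔ g) := by
  refine (hf.abs.add hg.abs).of_abs_le (hf.1.max hg.1) fun t => ?_
  refine (abs_max_le_max_abs_abs (a := f t) (b := g t)).trans (le_trans ?_ (le_abs_self _))
  exact max_le_add_of_nonneg (abs_nonneg (f t)) (abs_nonneg (g t))

lemma PolyGrowth.inf (hf : PolyGrowth n f) (hg : PolyGrowth n g) : PolyGrowth n (f ⊓ g) := by
  rw [eq_sub_of_add_eq (inf_add_sup f g)]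
  exact (hf.add hg).sub (hf.sup hg)

lemma PolyGrowth.pow (hf : PolyGrowth n f) (k : ℕ) : PolyGrowth n (f ^ k) := by
  induction k with
  | zero => rw [pow_zero]; exact polyGrowth_one
  | succ k ih => rw [pow_succ]; exact ih.mul hf

end PolyGrowth

namespace IsLatAlgHom

variable {X : Type*} [Lattice X] [Ring X] [Algebra ℝ X] {n : ℕ}
  {Ψ : ∀ f : (Fin n → ℝ) → ℝ, PolyGrowth n f → X} {f g : (Fin n → ℝ) → ℝ}

lemma map_zero (hΨ : IsLatAlgHom (PolyGrowth n) Ψ) : Ψ 0 polyGrowth_zero = 0 := by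
  have h : ∀ g (hg : PolyGrowth n g), g = (0 : ℝ) • (0 : (Fin n → ℝ) → ℝ) → Ψ g hg = 0 := by
    rintro g hg rfl
    rw [hΨ.1.2.1 0 0 polyGrowth_zero, zero_smul]
  exact h _ _ (zero_smul ℝ _).symm

lemma map_neg (hΨ : IsLatAlgHom (PolyGrowth n) Ψ) (hf : PolyGrowth n f) :
    Ψ (-f) hf.neg = -Ψ f hf := by
  have h : ∀ g (hg : PolyGrowth n g), g = (-1 : ℝ) • f → Ψ g hg = -Ψ f hf := by
    rintro g hg rfl
    rw [hΨ.1.2.1 (-1) f hf, neg_one_smul]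
  exact h _ _ (neg_one_smul ℝ f).symm

lemma map_sub (hΨ : IsLatAlgHom (PolyGrowth n) Ψ) (hf : PolyGrowth n f) (hg : PolyGrowth n g) :
    Ψ (f - g) (hf.sub hg) = Ψ f hf - Ψ g hg := by
  have h : ∀ h (hh : PolyGrowth n h), h = f + -g → Ψ h hh = Ψ f hf - Ψ g hg := by
    rintro h hh rfl
    rw [hΨ.1.1 f (-g) hf hg.neg, hΨ.map_neg hg, sub_eq_add_neg]
  exact h _ _ (sub_eq_add_neg f g)

lemma map_abs (hΨ : IsLatAlgHom (PolyGrowth n) Ψ) (hf : PolyGrowth n f) :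
    Ψ |f| hf.abs = |Ψ f hf| :=
  (hΨ.1.2.2 f (-f) hf hf.neg _).trans (by rw [hΨ.map_neg hf]; rfl)

lemma mono (hΨ : IsLatAlgHom (PolyGrowth n) Ψ) (hf : PolyGrowth n f) (hg : PolyGrowth n g)
    (hfg : f ≤ g) : Ψ f hf ≤ Ψ g hg := by
  have h : ∀ h (hh : PolyGrowth n h), h = f ⊔ g → Ψ f hf ≤ Ψ h hh := by
    rintro h hh rfl
    rw [hΨ.1.2.2 f g hf hg]
    exact le_sup_left
  exact h _ _ (sup_eq_right.2 hfg).symm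

lemma map_fold (hΨ : IsLatAlgHom (PolyGrowth n) Ψ) (hΨ1 : ∀ h1 : PolyGrowth n 1, Ψ 1 h1 = 1)
    {ι : Type*} (g : ι → (Fin n → ℝ) → ℝ) (hg : ∀ i, PolyGrowth n (g i)) (s : Finset ι) :
    ∃ h : PolyGrowth n (s.fold (· ⊔ ·) 1 fun i => |g i|),
      Ψ _ h = s.fold (fun a b : X => a ⊔ b) 1 fun i => |Ψ (g i) (hg i)| := by
  classical
  induction s using Finset.induction_on with
  | empty => exact ⟨polyGrowth_one, hΨ1 _⟩
  | insert i s hi ih =>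
    obtain ⟨h, hs⟩ := ih
    rw [Finset.fold_insert hi]
    simp only [Finset.fold_insert hi]
    exact ⟨(hg i).abs.sup h, by rw [hΨ.1.2.2 _ _ (hg i).abs h, hs, hΨ.map_abs (hg i)]⟩

lemma map_pow_succ (hΨ : IsLatAlgHom (PolyGrowth n) Ψ) (hf : PolyGrowth n f) (m : ℕ) :
    Ψ (f ^ (m + 1)) (hf.pow (m + 1)) = Ψ f hf ^ (m + 1) := by
  induction m with
  | zero => simp only [zero_add, pow_one]
  | succ m ih =>
    rw [pow_succ (Ψ f hf), ← ih, ← hΨ.2 _ _ _ _ ((hf.pow (m + 1)).mul hf)]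
    simp only [pow_succ]

variable [IsOrderedAddMonoid X]

lemma map_inf (hΨ : IsLatAlgHom (PolyGrowth n) Ψ) (hf : PolyGrowth n f) (hg : PolyGrowth n g) :
    Ψ (f ⊓ g) (hf.inf hg) = Ψ f hf ⊓ Ψ g hg := by
  have h : ∀ h (hh : PolyGrowth n h), h = f + g - f ⊔ g → Ψ h hh = Ψ f hf ⊓ Ψ g hg := by
    rintro h hh rfl
    rw [hΨ.map_sub (hf.add hg) (hf.sup hg), hΨ.1.1 f g hf hg, hΨ.1.2.2 f g hf hg]
    exact (eq_sub_of_add_eq (inf_add_sup _ _)).symm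
  exact h _ _ (eq_sub_of_add_eq (inf_add_sup f g))

lemma isFSubalgebra_range (hΨ : IsLatAlgHom (PolyGrowth n) Ψ) :
    IsFSubalgebra {y : X | ∃ g hg, Ψ g hg = y} := by
  refine ⟨⟨⟨⟨0, polyGrowth_zero, hΨ.map_zero⟩, ?_, ?_, ?_, ?_, ?_⟩, ?_⟩, ?_⟩
  · rintro _ ⟨f, hf, rfl⟩ _ ⟨g, hg, rfl⟩
    exact ⟨f + g, hf.add hg, hΨ.1.1 f g hf hg _⟩
  · rintro c _ ⟨f, hf, rfl⟩
    exact ⟨c • f, hf.smul c, hΨ.1.2.1 c f hf _⟩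
  · rintro _ ⟨f, hf, rfl⟩
    exact ⟨-f, hf.neg, hΨ.map_neg hf⟩
  · rintro _ ⟨f, hf, rfl⟩ _ ⟨g, hg, rfl⟩
    exact ⟨f ⊔ g, hf.sup hg, hΨ.1.2.2 f g hf hg _⟩
  · rintro _ ⟨f, hf, rfl⟩ _ ⟨g, hg, rfl⟩
    exact ⟨f ⊓ g, hf.inf hg, hΨ.map_inf hf hg⟩
  · rintro _ ⟨f, hf, rfl⟩ _ ⟨g, hg, rfl⟩
    exact ⟨f * g, hf.mul hg, hΨ.2 f g hf hg _⟩
  · rintro _ ⟨f, hf, rfl⟩ _ ⟨g, hg, rfl⟩ _ ⟨h, hh, rfl⟩ hfg hh0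
    have hf' := hf.sub (hf.inf hg)
    have hg' := hg.sub (hf.inf hg)
    have hfe : Ψ f hf = Ψ _ hf' := by
      rw [hΨ.map_sub hf (hf.inf hg), hΨ.map_inf hf hg, hfg, sub_zero]
    have hge : Ψ g hg = Ψ _ hg' := by
      rw [hΨ.map_sub hg (hf.inf hg), hΨ.map_inf hf hg, hfg, sub_zero]
    have hhe : Ψ h hh = Ψ _ hh.abs := by rw [hΨ.map_abs hh, abs_of_nonneg hh0]
    have key : (|h| * (f - f ⊓ g)) ⊓ (g - f ⊓ g) = 0 := by
      funext t
      change min (|h t| * (f t - min (f t) (g t))) (g t - min (f t) (g t)) = 0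
      rcases le_total (f t) (g t) with hle | hle
      · rw [min_eq_left hle, sub_self, mul_zero, min_eq_left (sub_nonneg.2 hle)]
      · rw [min_eq_right hle, sub_self,
          min_eq_right (mul_nonneg (abs_nonneg _) (sub_nonneg.2 hle))]
    have h0 : ∀ k (hk : PolyGrowth n k), k = 0 → Ψ k hk = 0 := by
      rintro k hk rfl
      exact hΨ.map_zero
    rw [hfe, hge, hhe, ← hΨ.2 _ _ hh.abs hf' (hh.abs.mul hf'),
      ← hΨ.2 _ _ hf' hh.abs (hf'.mul hh.abs), ← hΨ.map_inf (hh.abs.mul hf') hg',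
      ← hΨ.map_inf (hf'.mul hh.abs) hg']
    exact ⟨h0 _ _ key, h0 _ _ (by rw [mul_comm, key])⟩

end IsLatAlgHom

namespace IsLatAlgHom

variable {X : Type*} [Lattice X] [Ring X] [Algebra ℝ X] {n : ℕ}
  {Ψ : ∀ f : (Fin n → ℝ) → ℝ, PolyGrowth n f → X}

lemma abs_map_sub_map_le (hΨ : IsLatAlgHom (PolyGrowth n) Ψ) {f g w : (Fin n → ℝ) → ℝ}
    (hf : PolyGrowth n f) (hg : PolyGrowth n g) (hw : PolyGrowth n w) {c : ℝ}
    (h : ∀ t, |f t - g t| ≤ c * w t) : |Ψ f hf - Ψ g hg| ≤ c • Ψ w hw := by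
  rw [← hΨ.map_sub hf hg, ← hΨ.map_abs (hf.sub hg), ← hΨ.1.2.1 c w hw (hw.smul c)]
  exact hΨ.mono _ _ h

variable [IsOrderedAddMonoid X]

/-- Lifting a relatively uniformly small increment through a lattice-algebra homomorphism. -/
lemma exists_map_eq_of_abs_sub_le (hΨ : IsLatAlgHom (PolyGrowth n) Ψ) {w : (Fin n → ℝ) → ℝ}
    (hw : PolyGrowth n w) (hw0 : ∀ t, 0 ≤ w t) {c : ℝ} (hc : 0 ≤ c)
    {f g : (Fin n → ℝ) → ℝ} (hf : PolyGrowth n f) (hg : PolyGrowth n g)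
    (h : |Ψ g hg - Ψ f hf| ≤ c • Ψ w hw) :
    ∃ (k : (Fin n → ℝ) → ℝ) (hk : PolyGrowth n k), Ψ k hk = Ψ g hg ∧
      ∀ t, |f t - k t| ≤ c * w t := by
  have hcw := hw.smul c
  have hd := hg.sub hf
  refine ⟨f + ((g - f) ⊔ -(c • w)) ⊓ (c • w), hf.add ((hd.sup hcw.neg).inf hcw), ?_, fun t => ?_⟩
  · rw [hΨ.1.1 _ _ hf ((hd.sup hcw.neg).inf hcw), hΨ.map_inf (hd.sup hcw.neg) hcw,
      hΨ.1.2.2 _ _ hd hcw.neg, hΨ.map_neg hcw, hΨ.map_sub hg hf, hΨ.1.2.1 c w hw,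
      sup_eq_left.2 (neg_le.1 (abs_le'.1 h).2), inf_eq_left.2 (abs_le'.1 h).1, add_sub_cancel]
  · change |f t - (f t + min (max (g t - f t) (-(c * w t))) (c * w t))| ≤ c * w t
    have h0 : 0 ≤ c * w t := mul_nonneg hc (hw0 t)
    rw [sub_add_cancel_left, abs_neg, abs_le]
    exact ⟨le_min (le_max_right _ _) (by linarith), min_le_right _ _⟩

lemma exists_seq_lift (hΨ : IsLatAlgHom (PolyGrowth n) Ψ) {w : (Fin n → ℝ) → ℝ}
    (hw : PolyGrowth n w) (hw0 : ∀ t, 0 ≤ w t) {v : ℕ → X} (hv : ∀ k, ∃ g hg, Ψ g hg = v k)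
    (hvW : ∀ k, |v (k + 1) - v k| ≤ ((1 : ℝ) / 2 / 2 ^ k) • Ψ w hw) :
    ∃ (G : ℕ → (Fin n → ℝ) → ℝ) (hG : ∀ k, PolyGrowth n (G k)), (∀ k, Ψ (G k) (hG k) = v k) ∧
      ∀ k t, |G k t - G (k + 1) t| ≤ 1 / 2 / 2 ^ k * w t := by
  have step : ∀ (k : ℕ) (f : {f : (Fin n → ℝ) → ℝ // ∃ hf : PolyGrowth n f, Ψ f hf = v k}),
      ∃ g : {g : (Fin n → ℝ) → ℝ // ∃ hg : PolyGrowth n g, Ψ g hg = v (k + 1)},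
        ∀ t, |f.1 t - g.1 t| ≤ 1 / 2 / 2 ^ k * w t := by
    rintro k ⟨f, hf, hfv⟩
    obtain ⟨g, hg, hgv⟩ := hv (k + 1)
    obtain ⟨l, hl, hlg, hle⟩ := hΨ.exists_map_eq_of_abs_sub_le hw hw0
      (c := 1 / 2 / 2 ^ k) (by positivity) hf hg (by rw [hfv, hgv]; exact hvW k)
    exact ⟨⟨l, hl, hlg.trans hgv⟩, hle⟩
  choose next hnext using step
  let G : ∀ k, {f : (Fin n → ℝ) → ℝ // ∃ hf : PolyGrowth n f, Ψ f hf = v k} := fun k =>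
    Nat.rec ⟨(hv 0).choose, (hv 0).choose_spec⟩ next k
  exact ⟨fun k => (G k).1, fun k => (G k).2.choose, fun k => (G k).2.choose_spec,
    fun k t => hnext k (G k) t⟩

lemma exists_limit (hΨ : IsLatAlgHom (PolyGrowth n) Ψ) {w : (Fin n → ℝ) → ℝ}
    (hw : PolyGrowth n w) (hw0 : ∀ t, 0 < w t) {v : ℕ → X} (hv : ∀ k, ∃ g hg, Ψ g hg = v k)
    (hvW : ∀ k, |v (k + 1) - v k| ≤ ((1 : ℝ) / 2 / 2 ^ k) • Ψ w hw) :
    ∃ (l : (Fin n → ℝ) → ℝ) (hl : PolyGrowth n l),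
      ∀ k, |v k - Ψ l hl| ≤ ((1 : ℝ) / 2 ^ k) • Ψ w hw := by
  obtain ⟨G, hG, hGv, hGw⟩ := hΨ.exists_seq_lift hw (fun t => (hw0 t).le) hv hvW
  have hdist : ∀ t k, dist (G k t / w t) (G (k + 1) t / w t) ≤ 1 / 2 / 2 ^ k := by
    intro t k
    rw [Real.dist_eq, ← sub_div, abs_div, abs_of_pos (hw0 t), div_le_iff₀ (hw0 t)]
    exact hGw k t
  choose L hL using fun t =>
    cauchySeq_tendsto_of_complete (cauchySeq_of_le_geometric_two (hdist t))
  have hle : ∀ k t, dist (G k t / w t) (L t) ≤ 1 / 2 ^ k := fun k t =>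
    dist_le_of_le_geometric_two_of_tendsto (hdist t) (hL t) k
  have hunif : TendstoUniformly (fun k t => G k t / w t) L Filter.atTop := by
    refine Metric.tendstoUniformly_iff.2 fun ε hε => ?_
    obtain ⟨K, hK⟩ := exists_pow_lt_of_lt_one hε (one_half_lt_one : (1 / 2 : ℝ) < 1)
    filter_upwards [Filter.eventually_ge_atTop K] with k hk t
    rw [dist_comm]
    refine (hle k t).trans_lt (lt_of_le_of_lt ?_ hK)
    rw [one_div_pow]
    exact one_div_le_one_div_of_le (by positivity) (pow_le_pow_right₀ one_le_two hk)
  have hLc : Continuous L := hunif.continuous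
    (Filter.Frequently.of_forall fun k => (hG k).1.div hw.1 fun t => (hw0 t).ne')
  have hlG : ∀ k t, |G k t - (w * L) t| ≤ 1 / 2 ^ k * w t := by
    intro k t
    have h1 := hle k t
    rw [Real.dist_eq, div_sub' (hw0 t).ne', abs_div, abs_of_pos (hw0 t),
      div_le_iff₀ (hw0 t)] at h1
    exact h1
  have hl : PolyGrowth n (w * L) := by
    refine ((hG 0).abs.add hw).of_abs_le (hw.1.mul hLc) fun t => le_trans ?_ (le_abs_self _)
    have h1 := hlG 0 t
    rw [pow_zero, div_one, one_mul, abs_sub_comm] at h1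
    have h2 := abs_add_le ((w * L) t - G 0 t) (G 0 t)
    rw [sub_add_cancel] at h2
    change _ ≤ |G 0 t| + w t
    linarith
  refine ⟨w * L, hl, fun k => ?_⟩
  rw [← hGv k]
  exact hΨ.abs_map_sub_map_le (hG k) hl hw (hlG k)

variable [IsOrderedModule ℝ X]

lemma normComplete_range (hΨ : IsLatAlgHom (PolyGrowth n) Ψ) {w : (Fin n → ℝ) → ℝ}
    (hw : PolyGrowth n w) (hw0 : ∀ t, 0 < w t) :
    NormComplete (Ψ w hw) ({y : X | ∃ g hg, Ψ g hg = y} ∩ idealSet (Ψ w hw)) := by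
  intro u hu hcau
  have hW : 0 ≤ Ψ w hw := by
    rw [← hΨ.map_zero]
    exact hΨ.mono _ hw fun t => (hw0 t).le
  have hc : ∀ k : ℕ, ∃ N : ℕ, ∀ p q, N ≤ p → N ≤ q →
      |u p - u q| ≤ ((1 : ℝ) / 2 / 2 ^ k) • Ψ w hw := fun k => by
    obtain ⟨N, hN⟩ := hcau (1 / 2 / 2 ^ k) (by positivity)
    exact ⟨N, fun p q hp hq =>
      abs_le_smul_of_regNorm_lt hW (sub_mem_idealSet (hu p).2 (hu q).2) (hN p q hp hq)⟩
  choose N hN using hc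
  have hle : ∀ j k, j ≤ k → N j ≤ ∑ i ∈ Finset.range (k + 1), N i := fun j k hjk =>
    Finset.single_le_sum (f := N) (fun _ _ => Nat.zero_le _)
      (Finset.mem_range.2 (Nat.lt_succ_of_le hjk))
  obtain ⟨l, hl, hlv⟩ := hΨ.exists_limit hw hw0
    (v := fun k => u (∑ i ∈ Finset.range (k + 1), N i)) (fun k => (hu _).1)
    (fun k => hN k _ _ (hle k (k + 1) k.le_succ) (hle k k le_rfl))
  refine ⟨Ψ l hl, ⟨⟨l, hl, rfl⟩, ?_⟩, fun ε hε => ?_⟩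
  · have h0 : u (∑ i ∈ Finset.range (0 + 1), N i) - Ψ l hl ∈ idealSet (Ψ w hw) :=
      ⟨_, by positivity, hlv 0⟩
    have h1 := sub_mem_idealSet (hu (∑ i ∈ Finset.range (0 + 1), N i)).2 h0
    rwa [sub_sub_cancel] at h1
  · obtain ⟨K, hK⟩ := exists_pow_lt_of_lt_one (half_pos hε) (one_half_lt_one : (1 / 2 : ℝ) < 1)
    refine ⟨N K, fun p hp => ?_⟩
    have h1 := abs_add_le_add_smul (hN K p _ hp (hle K K le_rfl)) (hlv K)
    rw [sub_add_sub_cancel] at h1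
    refine (regNorm_le_of_abs_le_smul (by positivity) h1).trans_lt ?_
    rw [one_div_pow] at hK
    have h2 : (1 : ℝ) / 2 / 2 ^ K = 1 / 2 * (1 / 2 ^ K) := by ring
    have h3 : (0 : ℝ) < 1 / 2 ^ K := by positivity
    linarith

end IsLatAlgHom

theorem isLatAlgHom_iff_normComplete {X : Type*} [Lattice X] [Ring X] [Algebra ℝ X]
    [IsOrderedAddMonoid X] [IsOrderedModule ℝ X]
    (hmul : ∀ a b : X, 0 ≤ a → 0 ≤ b → 0 ≤ a * b)
    (harch : ∀ y z : X, 0 ≤ y → (∀ k : ℕ, k • y ≤ z) → y = 0)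
    (n : ℕ) (x : Fin n → X) :
    let C1 : Prop := ∃ Ψ : ∀ f : (Fin n → ℝ) → ℝ, PolyGrowth n f → X,
      IsLatAlgHom (PolyGrowth n) Ψ ∧
      (∀ h1 : PolyGrowth n 1, Ψ 1 h1 = 1) ∧
      (∀ (i : Fin n) (hi : PolyGrowth n fun t => t i), Ψ (fun t => t i) hi = x i)
    let e : X := Finset.univ.fold (· ⊔ ·) 1 fun i => |x i|
    let C2 : Prop := ∃ Y : Set X, IsFSubalgebra Y ∧ (1 : X) ∈ Y ∧ (∀ i, x i ∈ Y) ∧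
      ∀ m : ℕ, NormComplete (e ^ (m + 1)) (Y ∩ idealSet (e ^ (m + 1)))
    let C3 : Prop := ∃ f : X, e ≤ f ∧ ∃ Y : Set X, IsFSubalgebra Y ∧ (1 : X) ∈ Y ∧
      (∀ i, x i ∈ Y) ∧
      ∀ m : ℕ, NormComplete (f ^ (m + 1)) (Y ∩ idealSet (f ^ (m + 1)))
    (C1 ↔ C2) ∧ (C2 ↔ C3) := by
  intro C1 e C2 C3
  have h12 : C1 → C2 := by
    rintro ⟨Ψ, hΨ, hΨ1, hΨx⟩
    refine ⟨_, hΨ.isFSubalgebra_range, ⟨1, polyGrowth_one, hΨ1 _⟩,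
      fun i => ⟨_, polyGrowth_coord i, hΨx i _⟩, fun m => ?_⟩
    obtain ⟨hE, hEe⟩ := hΨ.map_fold hΨ1 (fun i t => t i) polyGrowth_coord Finset.univ
    simp only [hΨx] at hEe
    have hE1 := le_fold_sup (1 : (Fin n → ℝ) → ℝ) (fun i => |fun t => t i|) Finset.univ
    have h0 := hΨ.normComplete_range (hE.pow (m + 1)) fun t =>
      pow_pos (zero_lt_one.trans_le (hE1 t)) (m + 1)
    rw [hΨ.map_pow_succ hE, hEe] at h0
    exact h0
  have h23 : C2 → C3 := fun ⟨Y, hY⟩ => ⟨e, le_rfl, Y, hY⟩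
  have h31 : C3 → C1 := by
    rintro ⟨f, hef, Y, hY, h1, hx, hc⟩
    have hc0 := hc 0
    rw [zero_add, pow_one] at hc0
    exact exists_isLatAlgHom_of_normComplete hmul harch ((le_fold_sup 1 _ _).trans hef) hY h1
      hc0 hx
  exact ⟨⟨h12, fun h => h31 (h23 h)⟩, ⟨h23, fun h => h12 (h31 h)⟩⟩

/-- Theorem 3.1 / `thm:conditions`, equivalence part. -/
theorem stmt_0 {X : Type*} [Lattice X] [Ring X] [Module ℝ X]
    [CovariantClass X X (· + ·) (· ≤ ·)] [IsScalarTower ℝ X X] [SMulCommClass ℝ X X]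
    (hsmulpos : ∀ (c : ℝ) (y : X), 0 ≤ c → 0 ≤ y → 0 ≤ c • y)
    (hmulpos : ∀ y z : X, 0 ≤ y → 0 ≤ z → 0 ≤ y * z)
    (harch : ∀ y z : X, 0 ≤ y → 0 ≤ z → (∀ k : ℕ, k • y ≤ z) → y = 0)
    (n : ℕ) (x : Fin n → X) :
    let C1 : Prop := ∃ Ψ : ∀ f : (Fin n → ℝ) → ℝ, PolyGrowth n f → X,
      IsLatAlgHom (PolyGrowth n) Ψ ∧
      (∀ h1 : PolyGrowth n 1, Ψ 1 h1 = 1) ∧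
      (∀ (i : Fin n) (hi : PolyGrowth n fun t => t i), Ψ (fun t => t i) hi = x i)
    let e : X := Finset.univ.fold (· ⊔ ·) 1 fun i => |x i|
    let C2 : Prop := ∃ Y : Set X, IsFSubalgebra Y ∧ (1 : X) ∈ Y ∧ (∀ i, x i ∈ Y) ∧
      ∀ m : ℕ, NormComplete (e ^ (m + 1)) (Y ∩ idealSet (e ^ (m + 1)))
    let C3 : Prop := ∃ f : X, e ≤ f ∧ ∃ Y : Set X, IsFSubalgebra Y ∧ (1 : X) ∈ Y ∧
      (∀ i, x i ∈ Y) ∧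
      ∀ m : ℕ, NormComplete (f ^ (m + 1)) (Y ∩ idealSet (f ^ (m + 1)))
    (C1 ↔ C2) ∧ (C2 ↔ C3) := by
  have _ : IsOrderedAddMonoid X :=
    { add_le_add_left := fun a b h c => by
        rw [add_comm a, add_comm b]
        exact CovariantClass.elim c h }
  have _ : IsOrderedModule ℝ X := IsOrderedModule.of_smul_nonneg fun c hc y hy => hsmulpos c y hc hy
  let _ : Algebra ℝ X := Algebra.ofModule smul_mul_assoc mul_smul_comm
  exact isLatAlgHom_iff_normComplete hmulpos
    (fun y z hy h => harch y z hy (by simpa using h 0) h) n x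
end

section
/- Let X be a lattice-ordered algebra such that for every n ∈ ℕ and every x₁, …, xₙ ∈ X there exists a lattice-algebra homomorphism Ψ : PG_n^h → X with Ψ(πᵢ) = xᵢ for i = 1, …, n. Then X is a commutative f-algebra: its multiplication is commutative, and whenever x ∧ y = 0 and z ≥ 0, one has (z·x) ∧ y = 0 and (x·z) ∧ y = 0. -/
open scoped BigOperators

namespace PosHomog

variable {n : ℕ} {f g : (Fin n → ℝ) → ℝ}

theorem coord (i : Fin n) : PosHomog n fun t => t i :=
  ⟨continuous_apply i, fun _ _ _ => rfl⟩

theorem add (hf : PosHomog n f) (hg : PosHomog n g) : PosHomog n (f + g) :=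
  ⟨hf.1.add hg.1, fun c hc t => by simp [hf.2 c hc, hg.2 c hc, mul_add]⟩

theorem smul (a : ℝ) (hf : PosHomog n f) : PosHomog n (a • f) :=
  ⟨hf.1.const_smul a, fun c hc t => by simp [hf.2 c hc, mul_left_comm]⟩

theorem sup (hf : PosHomog n f) (hg : PosHomog n g) : PosHomog n (f ⊔ g) :=
  ⟨hf.1.sup hg.1, fun c hc t => by
    simp [hf.2 c hc, hg.2 c hc, mul_max_of_nonneg _ _ hc]⟩

/-- A continuous positively homogeneous function is dominated by a multiple of the norm. -/
theorem exists_abs_le_mul_norm (hf : PosHomog n f) :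
    ∃ C : ℝ, 0 ≤ C ∧ ∀ t, |f t| ≤ C * ‖t‖ := by
  obtain ⟨C, hC⟩ := (isCompact_closedBall (0 : Fin n → ℝ) 1).exists_bound_of_continuousOn
    hf.1.continuousOn
  refine ⟨C, (norm_nonneg _).trans (hC 0 (by simp)), fun t => ?_⟩
  rcases eq_or_ne t 0 with rfl | ht
  · have h := hf.2 0 le_rfl 0
    simp only [zero_smul, zero_mul] at h
    simp [h]
  · have ht' : ‖t‖ ≠ 0 := norm_ne_zero_iff.mpr ht
    have h := hf.2 ‖t‖ (norm_nonneg t) (‖t‖⁻¹ • t)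
    rw [smul_smul, mul_inv_cancel₀ ht', one_smul] at h
    rw [h, abs_mul, abs_norm, mul_comm]
    refine mul_le_mul_of_nonneg_right (hC _ ?_) (norm_nonneg t)
    simp [norm_smul, ht']

theorem norm_le_one_add_sum (t : Fin n → ℝ) : ‖t‖ ≤ 1 + ∑ i, |t i| := by
  have h : 0 ≤ ∑ i, |t i| := Finset.sum_nonneg fun i _ => abs_nonneg _
  refine (pi_norm_le_iff_of_nonneg (by linarith)).mpr fun i => ?_
  have := Finset.single_le_sum (f := fun j => |t j|) (fun j _ => abs_nonneg _) (Finset.mem_univ i)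
  simp only [Real.norm_eq_abs] at *
  linarith

theorem polyGrowthH (hf : PosHomog n f) : PolyGrowthH n f := by
  obtain ⟨C, hC, hfC⟩ := hf.exists_abs_le_mul_norm
  refine ⟨⟨hf.1, C, 1, hC, fun t => (hfC t).trans ?_⟩, f, fun B _ ε hε =>
    ⟨1, one_pos, fun t ht _ y _ => ?_⟩⟩
  · rw [pow_one]
    exact mul_le_mul_of_nonneg_left (norm_le_one_add_sum t) hC
  · rw [hf.2 t ht.le, mul_div_cancel_left₀ _ ht.ne', sub_self, abs_zero]
    exact hε

theorem polyGrowthH_mul (hf : PosHomog n f) (hg : PosHomog n g) : PolyGrowthH n (f * g) := by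
  obtain ⟨C, hC, hfC⟩ := hf.exists_abs_le_mul_norm
  obtain ⟨D, hD, hgD⟩ := hg.exists_abs_le_mul_norm
  have hbound : ∀ t, |(f * g) t| ≤ C * D * ‖t‖ ^ 2 := fun t => by
    rw [Pi.mul_apply, abs_mul]
    calc |f t| * |g t| ≤ (C * ‖t‖) * (D * ‖t‖) :=
          mul_le_mul (hfC t) (hgD t) (abs_nonneg _) (by positivity)
      _ = C * D * ‖t‖ ^ 2 := by ring
  refine ⟨⟨hf.1.mul hg.1, C * D, 2, by positivity, fun t => (hbound t).trans ?_⟩, 0,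
    fun B hB ε hε => ?_⟩
  · have := norm_le_one_add_sum t
    gcongr
  · obtain ⟨R, hR⟩ := hB.exists_norm_le
    have hK : 0 < C * D * R ^ 2 + 1 := by positivity
    refine ⟨ε / (C * D * R ^ 2 + 1), div_pos hε hK, fun t ht htδ y hy => ?_⟩
    have hyR : |(f * g) y| ≤ C * D * R ^ 2 := (hbound y).trans <| by
      have := hR y hy
      gcongr
    have heq : (f * g) (t • y) / t = t * (f * g) y := by
      simp only [Pi.mul_apply, hf.2 t ht.le, hg.2 t ht.le]
      field_simp
    rw [heq, Pi.zero_apply, sub_zero, abs_mul, abs_of_pos ht]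
    rw [lt_div_iff₀ hK] at htδ
    nlinarith

end PosHomog

theorem sub_sup_zero_of_inf_eq_zero {X : Type*} [Lattice X] [AddCommGroup X]
    [CovariantClass X X (· + ·) (· ≤ ·)] {a b : X}
    (h : a ⊓ b = 0) : (a - b) ⊔ 0 = a := by
  have := sup_sub (a := a) (b := b) (c := b)
  rw [sub_self] at this
  have h' := inf_add_sup a b
  rw [h, zero_add] at h'
  rw [← this, h', add_sub_cancel_right]

section Calculus

variable {X : Type*} [Lattice X] [NonUnitalRing X] [Module ℝ X]

theorem mul_comm_of_polyGrowthH_calculus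
    (hcalc : ∀ (n : ℕ) (x : Fin n → X), ∃ Ψ : ∀ f : (Fin n → ℝ) → ℝ, PolyGrowthH n f → X,
      IsLatAlgHom (PolyGrowthH n) Ψ ∧
      ∀ (i : Fin n) (hi : PolyGrowthH n fun t => t i), Ψ (fun t => t i) hi = x i)
    (a b : X) : a * b = b * a := by
  obtain ⟨Ψ, ⟨-, hmul⟩, hx⟩ := hcalc 2 ![a, b]
  have h0 := PosHomog.coord (n := 2) 0
  have h1 := PosHomog.coord (n := 2) 1
  have hab := hmul _ _ h0.polyGrowthH h1.polyGrowthH (h0.polyGrowthH_mul h1)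
  have hba := hmul _ _ h1.polyGrowthH h0.polyGrowthH (h1.polyGrowthH_mul h0)
  have ha : Ψ _ h0.polyGrowthH = a := hx 0 _
  have hb : Ψ _ h1.polyGrowthH = b := hx 1 _
  rw [ha, hb] at hab hba
  rw [← hab, ← hba]
  congr 1
  exact mul_comm _ _

theorem mul_inf_eq_zero_of_polyGrowthH_calculus [CovariantClass X X (· + ·) (· ≤ ·)]
    (hcalc : ∀ (n : ℕ) (x : Fin n → X), ∃ Ψ : ∀ f : (Fin n → ℝ) → ℝ, PolyGrowthH n f → X,
      IsLatAlgHom (PolyGrowthH n) Ψ ∧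
      ∀ (i : Fin n) (hi : PolyGrowthH n fun t => t i), Ψ (fun t => t i) hi = x i)
    {a b z : X} (hab : a ⊓ b = 0) (hz : 0 ≤ z) : (z * a) ⊓ b = 0 := by
  obtain ⟨Ψ, ⟨⟨hadd, hsmul, hsup⟩, hmul⟩, hx⟩ := hcalc 3 ![a, b, z]
  have h0 := PosHomog.coord (n := 3) 0
  have h1 := PosHomog.coord (n := 3) 1
  have h2 := PosHomog.coord (n := 3) 2
  have ha : Ψ _ h0.polyGrowthH = a := hx 0 _
  have hb : Ψ _ h1.polyGrowthH = b := hx 1 _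
  have hc : Ψ _ h2.polyGrowthH = z := hx 2 _
  have hzero := h0.smul 0
  have hΨzero : Ψ _ hzero.polyGrowthH = 0 := by
    rw [hsmul _ _ h0.polyGrowthH, zero_smul]
  -- the positive parts of `π₀ - π₁` and `π₁ - π₀`, whose images are `a` and `b`
  have hp' := h0.add (h1.smul (-1))
  have hp := hp'.sup hzero
  have hΨp : Ψ _ hp.polyGrowthH = a := by
    rw [hsup _ _ hp'.polyGrowthH hzero.polyGrowthH,
      hadd _ _ h0.polyGrowthH (h1.smul (-1)).polyGrowthH,
      hsmul _ _ h1.polyGrowthH, hΨzero, ha, hb, neg_one_smul, ← sub_eq_add_neg]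
    exact sub_sup_zero_of_inf_eq_zero hab
  have hq' := h1.add (h0.smul (-1))
  have hq := hq'.sup hzero
  have hΨq : Ψ _ hq.polyGrowthH = b := by
    rw [hsup _ _ hq'.polyGrowthH hzero.polyGrowthH,
      hadd _ _ h1.polyGrowthH (h0.smul (-1)).polyGrowthH,
      hsmul _ _ h0.polyGrowthH, hΨzero, ha, hb, neg_one_smul, ← sub_eq_add_neg]
    exact sub_sup_zero_of_inf_eq_zero (inf_comm a b ▸ hab)
  have hr := h2.sup hzero
  have hΨr : Ψ _ hr.polyGrowthH = z := by
    rw [hsup _ _ h2.polyGrowthH hzero.polyGrowthH, hΨzero, hc, sup_eq_left.mpr hz]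
  have hnr := hr.smul (-1)
  have hnq := hq.smul (-1)
  have hΨnr : Ψ _ hnr.polyGrowthH = -z := by
    rw [hsmul _ _ hr.polyGrowthH, hΨr, neg_one_smul]
  have hΨnq : Ψ _ hnq.polyGrowthH = -b := by
    rw [hsmul _ _ hq.polyGrowthH, hΨq, neg_one_smul]
  have hprod := hnr.polyGrowthH_mul hp
  have hΨprod := hmul _ _ hnr.polyGrowthH hp.polyGrowthH hprod
  rw [hΨnr, hΨp, neg_mul] at hΨprod
  have hfun := funext fun t : Fin 3 → ℝ => show
      (((-1 : ℝ) • ((fun t : Fin 3 → ℝ => t 2) ⊔ (0 : ℝ) • fun t : Fin 3 → ℝ => t 0)) *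
        (((fun t : Fin 3 → ℝ => t 0) + (-1 : ℝ) • fun t : Fin 3 → ℝ => t 1) ⊔
          (0 : ℝ) • fun t : Fin 3 → ℝ => t 0) ⊔
      (-1 : ℝ) • (((fun t : Fin 3 → ℝ => t 1) + (-1 : ℝ) • fun t : Fin 3 → ℝ => t 0) ⊔
          (0 : ℝ) • fun t : Fin 3 → ℝ => t 0)) t = ((0 : ℝ) • fun t : Fin 3 → ℝ => t 0) t by
    simp only [Pi.sup_apply, Pi.mul_apply, Pi.add_apply, Pi.smul_apply, smul_eq_mul, zero_mul,
      neg_one_mul, ← sub_eq_add_neg]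
    have hr0 : 0 ≤ t 2 ⊔ 0 := le_sup_right
    rcases le_total (t 0) (t 1) with h | h
    · rw [sup_eq_right.mpr (sub_nonpos.mpr h), sup_eq_left.mpr (sub_nonneg.mpr h), mul_zero]
      exact sup_eq_left.mpr (by linarith)
    · rw [sup_eq_left.mpr (sub_nonneg.mpr h), sup_eq_right.mpr (sub_nonpos.mpr h), neg_zero]
      exact sup_eq_right.mpr (by nlinarith [sub_nonneg.mpr h])
  have hΨsup := hsup _ _ hprod hnq.polyGrowthH (by rw [hfun]; exact hzero.polyGrowthH)
  rw [hΨprod, hΨnq, ← neg_inf] at hΨsup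
  rw [← neg_eq_zero, ← hΨsup, ← hΨzero]
  congr 1

end Calculus

/-- Proposition 2.5 / `prop:admitPG`: a lattice-ordered algebra admitting a
polynomial growth continuous function calculus without constants is a commutative `f`-algebra. -/
theorem stmt_2 {X : Type*} [Lattice X] [NonUnitalRing X] [Module ℝ X]
    [CovariantClass X X (· + ·) (· ≤ ·)] [IsScalarTower ℝ X X] [SMulCommClass ℝ X X]
    (hsmulpos : ∀ (c : ℝ) (y : X), 0 ≤ c → 0 ≤ y → 0 ≤ c • y)
    (hmulpos : ∀ y z : X, 0 ≤ y → 0 ≤ z → 0 ≤ y * z)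
    (hcalc : ∀ (n : ℕ) (x : Fin n → X), ∃ Ψ : ∀ f : (Fin n → ℝ) → ℝ, PolyGrowthH n f → X,
      IsLatAlgHom (PolyGrowthH n) Ψ ∧
      ∀ (i : Fin n) (hi : PolyGrowthH n fun t => t i), Ψ (fun t => t i) hi = x i) :
    (∀ a b : X, a * b = b * a) ∧
    (∀ a b z : X, a ⊓ b = 0 → 0 ≤ z → (z * a) ⊓ b = 0 ∧ (a * z) ⊓ b = 0) := by
  have hcomm := mul_comm_of_polyGrowthH_calculus hcalc
  refine ⟨hcomm, fun a b z hab hz => ?_⟩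
  rw [hcomm a z]
  exact ⟨mul_inf_eq_zero_of_polyGrowthH_calculus hcalc hab hz,
    mul_inf_eq_zero_of_polyGrowthH_calculus hcalc hab hz⟩
end

section
/- Let X be an Archimedean vector lattice, let n ∈ ℕ and let x₁, …, xₙ ∈ X. Then the following are equivalent: (i) there is a vector lattice homomorphism Φ : H_n → X (a linear map preserving binary suprema) with Φ(πᵢ) = xᵢ for i = 1, …, n; (ii) setting e = |x₁| ∨ ⋯ ∨ |xₙ|, there exists a sublattice Y of X with x₁, …, xₙ ∈ Y such that the norm ‖·‖_e is complete on Y ∩ I_e; (iii) there exist f ∈ X with f ≥ |x₁| ∨ ⋯ ∨ |xₙ| and a sublattice Y of X with x₁, …, xₙ ∈ Y such that the norm ‖·‖_f is complete on Y ∩ I_f. Moreover, when these conditions hold, the lattice homomorphism Φ in (i) is unique. -/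
open scoped BigOperators

section VectorLattice

theorem abs_sub_le_add_abs_sub {X : Type*} [Lattice X] [AddCommGroup X] [IsOrderedAddMonoid X]
    (a b c : X) : |a - c| ≤ |a - b| + |b - c| := by
  simpa using abs_add_le (a - b) (b - c)

theorem abs_sup_sub_sup_le_add {X : Type*} [Lattice X] [AddCommGroup X] [IsOrderedAddMonoid X]
    (a b c d : X) : |a ⊔ b - c ⊔ d| ≤ |a - c| + |b - d| := by
  refine (abs_sub_le_add_abs_sub _ (c ⊔ b) _).trans (add_le_add (abs_sup_sub_sup_le_abs a c b) ?_)
  rw [sup_comm c b, sup_comm c d]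
  exact abs_sup_sub_sup_le_abs b d c

variable {X : Type*} [Lattice X] [AddCommGroup X] [Module ℝ X]

theorem smul_sup_of_nonneg [PosSMulMono ℝ X] {c : ℝ} (hc : 0 ≤ c) (a b : X) :
    c • (a ⊔ b) = c • a ⊔ c • b := by
  rcases hc.eq_or_lt with rfl | hc
  · simp
  · exact (OrderIso.smulRight (β := X) hc).map_sup a b

theorem abs_smul_of_nonneg [PosSMulMono ℝ X] {c : ℝ} (hc : 0 ≤ c) (a : X) : |c • a| = c • |a| := by
  rw [abs, abs, smul_sup_of_nonneg hc, smul_neg]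

theorem abs_smul_le [PosSMulMono ℝ X] (c : ℝ) (a : X) : |c • a| ≤ |c| • |a| := by
  rcases le_total 0 c with hc | hc
  · rw [abs_smul_of_nonneg hc, abs_of_nonneg hc]
  · rw [← abs_neg, ← neg_smul, abs_smul_of_nonneg (neg_nonneg.2 hc), abs_of_nonpos hc]

namespace IsSublatticeSet

variable {Z : Set X}

theorem zero_mem (h : IsSublatticeSet Z) : 0 ∈ Z := h.1

theorem add_mem (h : IsSublatticeSet Z) {a b : X} (ha : a ∈ Z) (hb : b ∈ Z) : a + b ∈ Z :=
  h.2.1 a ha b hb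

theorem smul_mem (h : IsSublatticeSet Z) (c : ℝ) {a : X} (ha : a ∈ Z) : c • a ∈ Z :=
  h.2.2.1 c a ha

theorem neg_mem (h : IsSublatticeSet Z) {a : X} (ha : a ∈ Z) : -a ∈ Z := h.2.2.2.1 a ha

theorem sup_mem (h : IsSublatticeSet Z) {a b : X} (ha : a ∈ Z) (hb : b ∈ Z) : a ⊔ b ∈ Z :=
  h.2.2.2.2.1 a ha b hb

theorem inf_mem (h : IsSublatticeSet Z) {a b : X} (ha : a ∈ Z) (hb : b ∈ Z) : a ⊓ b ∈ Z :=
  h.2.2.2.2.2 a ha b hb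

theorem sub_mem (h : IsSublatticeSet Z) {a b : X} (ha : a ∈ Z) (hb : b ∈ Z) : a - b ∈ Z :=
  sub_eq_add_neg a b ▸ h.add_mem ha (h.neg_mem hb)

theorem abs_mem (h : IsSublatticeSet Z) {a : X} (ha : a ∈ Z) : |a| ∈ Z :=
  h.sup_mem ha (h.neg_mem ha)

end IsSublatticeSet

theorem regNorm_le {f y : X} {c : ℝ} (hc : 0 ≤ c) (h : |y| ≤ c • f) : regNorm f y ≤ c :=
  csInf_le ⟨0, fun _ hd => hd.1⟩ ⟨hc, h⟩

variable [IsOrderedAddMonoid X]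

theorem smul_le_smul_of_coeff_le [PosSMulMono ℝ X] {c d : ℝ} {f : X} (h : c ≤ d) (hf : 0 ≤ f) :
    c • f ≤ d • f := by
  rw [← sub_nonneg, ← sub_smul]
  exact smul_nonneg (sub_nonneg.2 h) hf

theorem IsSublatticeSet.of_add_smul_sup {Z : Set X} (h0 : 0 ∈ Z)
    (hadd : ∀ a ∈ Z, ∀ b ∈ Z, a + b ∈ Z) (hsmul : ∀ (c : ℝ), ∀ a ∈ Z, c • a ∈ Z)
    (hsup : ∀ a ∈ Z, ∀ b ∈ Z, a ⊔ b ∈ Z) : IsSublatticeSet Z := by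
  have hneg : ∀ a ∈ Z, -a ∈ Z := fun a ha => by simpa using hsmul (-1) a ha
  refine ⟨h0, hadd, hsmul, hneg, hsup, fun a ha b hb => ?_⟩
  have := hneg _ (hsup _ (hneg a ha) _ (hneg b hb))
  rwa [neg_sup, neg_neg, neg_neg] at this

theorem isSublatticeSet_idealSet [PosSMulMono ℝ X] (f : X) :
    IsSublatticeSet (idealSet f) := by
  have sum_mem : ∀ a b : X, a ∈ idealSet f → b ∈ idealSet f → |a| + |b| ∈ idealSet f := by
    rintro a b ⟨c, hc, ha⟩ ⟨d, hd, hb⟩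
    refine ⟨c + d, add_nonneg hc hd, ?_⟩
    rw [abs_of_nonneg (add_nonneg (abs_nonneg a) (abs_nonneg b)), add_smul]
    exact add_le_add ha hb
  have solid : ∀ a b : X, a ∈ idealSet f → |b| ≤ |a| → b ∈ idealSet f := by
    rintro a b ⟨c, hc, ha⟩ hab
    exact ⟨c, hc, hab.trans ha⟩
  refine .of_add_smul_sup ⟨0, le_rfl, by simp⟩ (fun a ha b hb => ?_) ?_ (fun a ha b hb => ?_)
  · exact solid _ _ (sum_mem a b ha hb) ((abs_add_le a b).trans (le_abs_self _))
  · rintro c a ⟨d, hd, ha⟩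
    refine ⟨|c| * d, by positivity, (abs_smul_le c a).trans ?_⟩
    rw [mul_smul]
    exact smul_le_smul_of_nonneg_left ha (abs_nonneg c)
  · refine solid _ _ (sum_mem a b ha hb) ?_
    have := abs_sup_sub_sup_le_add a b 0 0
    simp only [sup_idem, sub_zero] at this
    exact this.trans (le_abs_self _)

theorem abs_le_smul_of_regNorm_lt_s3 [PosSMulMono ℝ X] {f y : X} {c : ℝ} (hf : 0 ≤ f)
    (hy : y ∈ idealSet f) (h : regNorm f y < c) : |y| ≤ c • f := by
  obtain ⟨d, ⟨-, hd⟩, hdc⟩ := exists_lt_of_csInf_lt hy h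
  exact hd.trans (smul_le_smul_of_coeff_le hdc.le hf)

theorem eq_of_forall_abs_sub_le_smul [PosSMulMono ℝ X]
    (harch : ∀ y z : X, 0 ≤ y → 0 ≤ z → (∀ k : ℕ, k • y ≤ z) → y = 0) {f a b : X} (hf : 0 ≤ f)
    (h : ∀ ε : ℝ, 0 < ε → |a - b| ≤ ε • f) : a = b := by
  have habs : |a - b| = 0 := by
    refine harch _ f (abs_nonneg _) hf fun k => ?_
    rcases Nat.eq_zero_or_pos k with rfl | hk
    · simpa using hf
    · have hk' : (0 : ℝ) < k := by exact_mod_cast hk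
      have := smul_le_smul_of_nonneg_left (h (k : ℝ)⁻¹ (inv_pos.2 hk')) hk'.le
      rwa [smul_smul, mul_inv_cancel₀ hk'.ne', one_smul, Nat.cast_smul_eq_nsmul] at this
  refine sub_eq_zero.1 (le_antisymm (habs ▸ le_abs_self _) ?_)
  have := neg_le_abs (a - b)
  rw [habs] at this
  exact neg_nonpos.1 this

end VectorLattice

section FunctionCalculus

open scoped Pointwise

variable {n : ℕ} {X : Type*} [Lattice X] [AddCommGroup X] [Module ℝ X]

/-- The coordinate projection `πᵢ` paired with `xᵢ`. -/
def coordPair (x : Fin n → X) (i : Fin n) : ((Fin n → ℝ) → ℝ) × X := (fun t => t i, x i)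

/-- The vector sublattice of `((Fin n → ℝ) → ℝ) × X` generated by the pairs `(πᵢ, xᵢ)`. -/
def genSublattice (x : Fin n → X) : Set (((Fin n → ℝ) → ℝ) × X) :=
  {p | ∀ S : Set (((Fin n → ℝ) → ℝ) × X), IsSublatticeSet S → (∀ i, coordPair x i ∈ S) → p ∈ S}

theorem coordPair_mem_genSublattice (x : Fin n → X) (i : Fin n) :
    coordPair x i ∈ genSublattice x := fun _ _ h => h i

theorem isSublatticeSet_genSublattice (x : Fin n → X) : IsSublatticeSet (genSublattice x) :=
  ⟨fun _ hS _ => hS.1,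
    fun _ ha _ hb S hS h => hS.add_mem (ha S hS h) (hb S hS h),
    fun c _ ha S hS h => hS.smul_mem c (ha S hS h),
    fun _ ha S hS h => hS.neg_mem (ha S hS h),
    fun _ ha _ hb S hS h => hS.sup_mem (ha S hS h) (hb S hS h),
    fun _ ha _ hb S hS h => hS.inf_mem (ha S hS h) (hb S hS h)⟩

/-- Differences of finite suprema of linear combinations of the vectors `vᵢ`. -/
def diffSup {V : Type*} [Lattice V] [AddCommGroup V] [Module ℝ V] (v : Fin n → V) : Set V :=
  {p | ∃ A B : Set (Fin n → ℝ), A.Finite ∧ B.Finite ∧ ∃ a b : V,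
    IsLUB (Fintype.linearCombination ℝ v '' A) a ∧ IsLUB (Fintype.linearCombination ℝ v '' B) b ∧
    p = a - b}

theorem isLUB_smul_image {V : Type*} [Lattice V] [AddCommGroup V] [Module ℝ V] [PosSMulMono ℝ V]
    (v : Fin n → V) {c : ℝ} (hc : 0 < c) {A : Set (Fin n → ℝ)} {a : V}
    (ha : IsLUB (Fintype.linearCombination ℝ v '' A) a) :
    IsLUB (Fintype.linearCombination ℝ v '' ((fun t => c • t) '' A)) (c • a) := by
  have := (OrderIso.smulRight (β := V) hc).isLUB_image'.2 ha
  rw [Set.image_image] at this ⊢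
  simpa using this

theorem isSublatticeSet_diffSup {V : Type*} [Lattice V] [AddCommGroup V] [IsOrderedAddMonoid V]
    [Module ℝ V] [PosSMulMono ℝ V] (v : Fin n → V) : IsSublatticeSet (diffSup v) := by
  have zero : (0 : V) ∈ diffSup v :=
    ⟨{0}, {0}, Set.finite_singleton _, Set.finite_singleton _, 0, 0, by simp, by simp, by simp⟩
  refine .of_add_smul_sup zero ?_ ?_ ?_
  · rintro _ ⟨A, B, hA, hB, a, b, ha, hb, rfl⟩ _ ⟨C, D, hC, hD, c, d, hc, hd, rfl⟩
    refine ⟨A + C, B + D, hA.add hC, hB.add hD, a + c, b + d, ?_, ?_, by abel⟩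
    · rw [Set.image_add]; exact ha.add hc
    · rw [Set.image_add]; exact hb.add hd
  · rintro r _ ⟨A, B, hA, hB, a, b, ha, hb, rfl⟩
    rcases lt_trichotomy r 0 with hr | rfl | hr
    · refine ⟨_, _, hB.image _, hA.image _, _, _, isLUB_smul_image v (neg_pos.2 hr) hb,
        isLUB_smul_image v (neg_pos.2 hr) ha, ?_⟩
      rw [← smul_sub, neg_smul, ← smul_neg, neg_sub]
    · simpa using zero
    · exact ⟨_, _, hA.image _, hB.image _, _, _, isLUB_smul_image v hr ha,
        isLUB_smul_image v hr hb, smul_sub _ _ _⟩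
  · rintro _ ⟨A, B, hA, hB, a, b, ha, hb, rfl⟩ _ ⟨C, D, hC, hD, c, d, hc, hd, rfl⟩
    refine ⟨(A + D) ∪ (C + B), B + D, (hA.add hD).union (hC.add hB), hB.add hD,
      (a + d) ⊔ (c + b), b + d, ?_, ?_, ?_⟩
    · rw [Set.image_union, Set.image_add, Set.image_add]
      exact (ha.add hd).union (hc.add hb)
    · rw [Set.image_add]; exact hb.add hd
    · rw [sub_eq_add_neg (_ ⊔ _), sup_add]
      congr 1 <;> abel

theorem mem_diffSup {V : Type*} [Lattice V] [AddCommGroup V] [Module ℝ V] (v : Fin n → V)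
    (i : Fin n) : v i ∈ diffSup v :=
  ⟨{Pi.single i 1}, {0}, Set.finite_singleton _, Set.finite_singleton _, v i, 0, by simp,
    by simp, by simp⟩

theorem linearCombination_coordPair_fst {X : Type*} [AddCommGroup X] [Module ℝ X]
    (x : Fin n → X) (a t : Fin n → ℝ) :
    (Fintype.linearCombination ℝ (coordPair x) a).1 t = ∑ i, a i * t i := by
  simp [Fintype.linearCombination_apply, coordPair, Prod.fst_sum, Finset.sum_apply]

theorem linearCombination_coordPair_snd {X : Type*} [AddCommGroup X] [Module ℝ X]
    (x : Fin n → X) (a : Fin n → ℝ) :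
    (Fintype.linearCombination ℝ (coordPair x) a).2 = Fintype.linearCombination ℝ x a := by
  simp [Fintype.linearCombination_apply, coordPair, Prod.snd_sum]

theorem mem_convexHull_of_forall_sum_mul_le {A : Set (Fin n → ℝ)} (hA : A.Finite) {b : Fin n → ℝ}
    (u : (Fin n → ℝ) → ℝ) (hu : ∀ t, IsLUB ((fun a : Fin n → ℝ => ∑ i, a i * t i) '' A) (u t))
    (hb : ∀ t, ∑ i, b i * t i ≤ u t) : b ∈ convexHull ℝ A := by
  by_contra hbA
  obtain ⟨φ, s, hs, hsb⟩ :=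
    geometric_hahn_banach_closed_point (convex_convexHull ℝ A)
      (hA.isClosed_convexHull (𝕜 := ℝ)) hbA
  have hφ : ∀ a : Fin n → ℝ, φ a = ∑ i, a i * φ (Pi.single i 1) := fun a => by
    conv_lhs => rw [pi_eq_sum_univ' a, map_sum]
    refine Finset.sum_congr rfl fun i _ => ?_
    rw [map_smul, smul_eq_mul]
  have hle : u (fun i => φ (Pi.single i 1)) ≤ s := by
    refine (hu _).2 ?_
    rintro _ ⟨a, ha, rfl⟩
    simp only [← hφ]
    exact (hs a (subset_convexHull ℝ A ha)).le
  have := hb fun i => φ (Pi.single i 1)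
  rw [← hφ] at this
  linarith

theorem norm_eq_fold (t : Fin n → ℝ) :
    ‖t‖ = Finset.univ.fold (· ⊔ · : ℝ → ℝ → ℝ) 0 fun i => |t i| := by
  refine le_antisymm ?_ ?_
  · refine (pi_norm_le_iff_of_nonneg ?_).2 fun i => ?_
    · exact (Finset.le_fold_max _).2 (Or.inl le_rfl)
    · exact (Finset.le_fold_max _).2 (Or.inr ⟨i, Finset.mem_univ i, le_rfl⟩)
  · exact (Finset.fold_max_le _).2 ⟨norm_nonneg t, fun i _ => norm_le_pi_norm t i⟩

/-- The element `|x₁| ⊔ ⋯ ⊔ |xₙ|`. -/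
def supAbs (x : Fin n → X) : X := Finset.univ.fold (· ⊔ ·) 0 fun i => |x i|

theorem norm_supAbs_mem {x : Fin n → X} {S : Set (((Fin n → ℝ) → ℝ) × X)} (hS : IsSublatticeSet S)
    (hx : ∀ i, coordPair x i ∈ S) :
    ((fun t => ‖t‖, supAbs x) : ((Fin n → ℝ) → ℝ) × X) ∈ S := by
  have key : ∀ s : Finset (Fin n), ((fun t => s.fold (· ⊔ · : ℝ → ℝ → ℝ) 0 fun i => |t i|,
      s.fold (· ⊔ ·) 0 fun i => |x i|) : ((Fin n → ℝ) → ℝ) × X) ∈ S := fun s => by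
    induction s using Finset.induction_on with
    | empty => exact hS.zero_mem
    | insert i s hi ih =>
      simp only [Finset.fold_insert hi]
      exact hS.sup_mem (hS.abs_mem (hx i)) ih
  simpa only [norm_eq_fold, supAbs] using key Finset.univ

theorem IsSublatticeSet.preimage_fst {V W : Type*} [Lattice V] [AddCommGroup V] [Module ℝ V]
    [Lattice W] [AddCommGroup W] [Module ℝ W] {Z : Set V} (h : IsSublatticeSet Z) :
    IsSublatticeSet (Prod.fst ⁻¹' Z : Set (V × W)) :=
  ⟨h.1, fun _ ha _ hb => h.add_mem ha hb, fun c _ ha => h.smul_mem c ha, fun _ ha => h.neg_mem ha,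
    fun _ ha _ hb => h.sup_mem ha hb, fun _ ha _ hb => h.inf_mem ha hb⟩

theorem IsSublatticeSet.preimage_snd {V W : Type*} [Lattice V] [AddCommGroup V] [Module ℝ V]
    [Lattice W] [AddCommGroup W] [Module ℝ W] {Z : Set W} (h : IsSublatticeSet Z) :
    IsSublatticeSet (Prod.snd ⁻¹' Z : Set (V × W)) :=
  ⟨h.1, fun _ ha _ hb => h.add_mem ha hb, fun c _ ha => h.smul_mem c ha, fun _ ha => h.neg_mem ha,
    fun _ ha _ hb => h.sup_mem ha hb, fun _ ha _ hb => h.inf_mem ha hb⟩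

theorem IsSublatticeSet.inter {V : Type*} [Lattice V] [AddCommGroup V] [Module ℝ V]
    {Y Z : Set V} (h : IsSublatticeSet Y) (k : IsSublatticeSet Z) : IsSublatticeSet (Y ∩ Z) :=
  ⟨⟨h.1, k.1⟩, fun _ ha _ hb => ⟨h.add_mem ha.1 hb.1, k.add_mem ha.2 hb.2⟩,
    fun c _ ha => ⟨h.smul_mem c ha.1, k.smul_mem c ha.2⟩,
    fun _ ha => ⟨h.neg_mem ha.1, k.neg_mem ha.2⟩,
    fun _ ha _ hb => ⟨h.sup_mem ha.1 hb.1, k.sup_mem ha.2 hb.2⟩,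
    fun _ ha _ hb => ⟨h.inf_mem ha.1 hb.1, k.inf_mem ha.2 hb.2⟩⟩

theorem isSublatticeSet_posHomog (n : ℕ) : IsSublatticeSet {f | PosHomog n f} := by
  refine .of_add_smul_sup ⟨continuous_const, by simp⟩ ?_ ?_ ?_
  · rintro f ⟨hf, hf'⟩ g ⟨hg, hg'⟩
    exact ⟨hf.add hg, fun c hc t => by simp [hf' c hc, hg' c hc, mul_add]⟩
  · rintro r f ⟨hf, hf'⟩
    exact ⟨hf.const_smul r, fun c hc t => by simp [hf' c hc, mul_left_comm]⟩
  · rintro f ⟨hf, hf'⟩ g ⟨hg, hg'⟩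
    exact ⟨hf.sup hg, fun c hc t => by
      simp [hf' c hc, hg' c hc, mul_max_of_nonneg _ _ hc]⟩

theorem posHomog_apply (i : Fin n) : PosHomog n fun t => t i :=
  ⟨continuous_apply i, fun c _ t => by simp⟩

theorem posHomog_of_mem_genSublattice {x : Fin n → X} {p : ((Fin n → ℝ) → ℝ) × X}
    (hp : p ∈ genSublattice x) : PosHomog n p.1 :=
  hp _ (isSublatticeSet_posHomog n).preimage_fst posHomog_apply

theorem PosHomog.abs_le_mul_norm {h : (Fin n → ℝ) → ℝ} (hh : PosHomog n h) {c : ℝ}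
    (hc : ∀ t, ‖t‖ = 1 → |h t| ≤ c) (t : Fin n → ℝ) : |h t| ≤ c * ‖t‖ := by
  rcases eq_or_ne t 0 with rfl | ht
  · have := hh.2 0 le_rfl 0
    simp_all
  · have hpos : 0 < ‖t‖ := norm_pos_iff.2 ht
    have h1 : ‖‖t‖⁻¹ • t‖ = 1 := by
      rw [norm_smul, norm_inv, norm_norm, inv_mul_cancel₀ hpos.ne']
    have h2 : h t = ‖t‖ * h (‖t‖⁻¹ • t) := by
      rw [← hh.2 _ hpos.le, smul_inv_smul₀ hpos.ne']
    rw [h2, abs_mul, abs_norm, mul_comm]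
    exact mul_le_mul_of_nonneg_right (hc _ h1) hpos.le

/-- The elements of the generated sublattice restrict to a dense set of functions on the sphere. -/
theorem exists_mem_genSublattice_abs_sub_le (x : Fin n → X) {h : (Fin n → ℝ) → ℝ}
    (hh : PosHomog n h) {ε : ℝ} (hε : 0 < ε) :
    ∃ p ∈ genSublattice x, ∀ t, |h t - p.1 t| ≤ ε * ‖t‖ := by
  have hG := isSublatticeSet_genSublattice x
  have hm := norm_supAbs_mem hG (coordPair_mem_genSublattice x)
  let L : Set C(Metric.sphere (0 : Fin n → ℝ) 1, ℝ) :=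
    {φ | ∃ p ∈ genSublattice x, ∀ s, φ s = p.1 s}
  have restrict : ∀ p ∈ genSublattice x, ∃ φ ∈ L, ∀ s, φ s = p.1 s := fun p hp =>
    ⟨⟨fun s => p.1 s, (posHomog_of_mem_genSublattice hp).1.comp continuous_subtype_val⟩,
      ⟨p, hp, fun _ => rfl⟩, fun _ => rfl⟩
  have dense : closure L = ⊤ := by
    refine ContinuousMap.sublattice_closure_eq_top L ⟨0, 0, hG.zero_mem, fun _ => rfl⟩ ?_ ?_ ?_
    · rintro φ ⟨p, hp, hφ⟩ ψ ⟨q, hq, hψ⟩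
      exact ⟨p ⊓ q, hG.inf_mem hp hq, fun s => by simp [hφ, hψ]⟩
    · rintro φ ⟨p, hp, hφ⟩ ψ ⟨q, hq, hψ⟩
      exact ⟨p ⊔ q, hG.sup_mem hp hq, fun s => by simp [hφ, hψ]⟩
    · intro v s t
      have hs : ‖(s : Fin n → ℝ)‖ = 1 := mem_sphere_zero_iff_norm.1 s.2
      have ht : ‖(t : Fin n → ℝ)‖ = 1 := mem_sphere_zero_iff_norm.1 t.2
      by_cases hst : s = t
      · subst hst
        obtain ⟨φ, hφ, hφ'⟩ := restrict _ (hG.smul_mem (v s) hm)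
        exact ⟨φ, hφ, by simp [hφ', hs], by simp [hφ', hs]⟩
      · obtain ⟨i, hi⟩ : ∃ i, (s : Fin n → ℝ) i ≠ (t : Fin n → ℝ) i := by
          by_contra! hall
          exact hst (Subtype.ext (funext hall))
        have hi' : (t : Fin n → ℝ) i - (s : Fin n → ℝ) i ≠ 0 := sub_ne_zero.2 hi.symm
        obtain ⟨φ, hφ, hφ'⟩ := restrict _ (hG.add_mem (hG.smul_mem (v s) hm)
          (hG.smul_mem ((v t - v s) / ((t : Fin n → ℝ) i - (s : Fin n → ℝ) i))
            (hG.sub_mem (coordPair_mem_genSublattice x i)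
              (hG.smul_mem ((s : Fin n → ℝ) i) hm))))
        refine ⟨φ, hφ, by simp [hφ', hs, coordPair], ?_⟩
        simp only [hφ', coordPair, Prod.fst_add, Prod.smul_fst, Prod.fst_sub, Pi.add_apply,
          Pi.smul_apply, Pi.sub_apply, ht, smul_eq_mul, mul_one]
        field_simp
        ring
  have hmem : (⟨fun s => h s, hh.1.comp continuous_subtype_val⟩ :
      C(Metric.sphere (0 : Fin n → ℝ) 1, ℝ)) ∈ closure L := dense ▸ Set.mem_univ _
  obtain ⟨φ, ⟨p, hp, hφ⟩, hdist⟩ := Metric.mem_closure_iff.1 hmem ε hε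
  refine ⟨p, hp, PosHomog.abs_le_mul_norm (h := h - p.1)
    ((isSublatticeSet_posHomog n).sub_mem hh (posHomog_of_mem_genSublattice hp)) fun t ht => ?_⟩
  have := (ContinuousMap.dist_apply_le_dist ⟨t, mem_sphere_zero_iff_norm.2 ht⟩).trans hdist.le
  rwa [hφ, Real.dist_eq] at this

/-- `y` is the value at `h` of the function calculus of `x`, as a limit relative to `f`. -/
def IsCalcValue (x : Fin n → X) (f : X) (h : (Fin n → ℝ) → ℝ) (y : X) : Prop :=
  ∀ ε : ℝ, 0 < ε → ∃ p ∈ genSublattice x, (∀ t, |h t - p.1 t| ≤ ε * ‖t‖) ∧ |y - p.2| ≤ ε • f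

variable [IsOrderedAddMonoid X]

theorem nonneg_of_mem_genSublattice [PosSMulMono ℝ X] {x : Fin n → X} {p : ((Fin n → ℝ) → ℝ) × X}
    (hp : p ∈ genSublattice x) (h : 0 ≤ p.1) : 0 ≤ p.2 := by
  obtain ⟨A, B, hA, -, a, b, ha, hb, rfl⟩ :=
    hp _ (isSublatticeSet_diffSup (coordPair x)) (mem_diffSup (coordPair x))
  rw [isLUB_prod, Set.image_image, Set.image_image] at ha hb
  simp only [linearCombination_coordPair_snd] at ha hb
  rw [Prod.snd_sub, sub_nonneg]
  rw [Prod.fst_sub, sub_nonneg] at h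
  refine hb.2.2 ?_
  rintro _ ⟨c, hc, rfl⟩
  have hlub : ∀ t, IsLUB ((fun a : Fin n → ℝ => ∑ i, a i * t i) '' A) (a.1 t) := fun t => by
    have := isLUB_pi.1 ha.1 t
    rw [Set.image_image] at this
    simpa only [Function.eval, linearCombination_coordPair_fst] using this
  have hcA : c ∈ convexHull ℝ A := by
    refine mem_convexHull_of_forall_sum_mul_le hA a.1 hlub fun t => ?_
    rw [← linearCombination_coordPair_fst x]
    exact (hb.1.1 ⟨c, hc, rfl⟩ t).trans (h t)
  have hconv : Convex ℝ {c : Fin n → ℝ | Fintype.linearCombination ℝ x c ≤ a.2} :=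
    (convex_Iic a.2).linear_preimage (Fintype.linearCombination ℝ x)
  exact convexHull_min (fun d hd => ha.2.1 ⟨d, hd, rfl⟩) hconv hcA

theorem abs_snd_sub_le {S : Set (((Fin n → ℝ) → ℝ) × X)} (hS : IsSublatticeSet S)
    (hpos : ∀ p ∈ S, 0 ≤ p.1 → 0 ≤ p.2) {m : ((Fin n → ℝ) → ℝ) × X} (hm : m ∈ S)
    {p q : ((Fin n → ℝ) → ℝ) × X} (hp : p ∈ S) (hq : q ∈ S) {c : ℝ}
    (h : ∀ t, |p.1 t - q.1 t| ≤ c * m.1 t) : |p.2 - q.2| ≤ c • m.2 := by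
  have := hpos (c • m - |p - q|) (hS.sub_mem (hS.smul_mem c hm) (hS.abs_mem (hS.sub_mem hp hq)))
    fun t => sub_nonneg.2 (h t)
  exact sub_nonneg.1 this

theorem supAbs_nonneg [PosSMulMono ℝ X] (x : Fin n → X) : 0 ≤ supAbs x :=
  nonneg_of_mem_genSublattice (norm_supAbs_mem (isSublatticeSet_genSublattice x)
    (coordPair_mem_genSublattice x)) fun t => norm_nonneg t

theorem abs_snd_sub_le_smul_supAbs [PosSMulMono ℝ X] {x : Fin n → X}
    {p q : ((Fin n → ℝ) → ℝ) × X} (hp : p ∈ genSublattice x) (hq : q ∈ genSublattice x) {c : ℝ}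
    (h : ∀ t, |p.1 t - q.1 t| ≤ c * ‖t‖) : |p.2 - q.2| ≤ c • supAbs x :=
  abs_snd_sub_le (isSublatticeSet_genSublattice x) (fun _ => nonneg_of_mem_genSublattice)
    (norm_supAbs_mem (isSublatticeSet_genSublattice x) (coordPair_mem_genSublattice x)) hp hq h

theorem abs_le_supAbs [PosSMulMono ℝ X] (x : Fin n → X) (i : Fin n) : |x i| ≤ supAbs x := by
  simpa [coordPair] using abs_snd_sub_le_smul_supAbs (c := 1) (coordPair_mem_genSublattice x i)
    (isSublatticeSet_genSublattice x).zero_mem fun t => by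
      simpa [coordPair] using norm_le_pi_norm t i

namespace IsCalcValue

variable {x : Fin n → X} {f : X} {h k : (Fin n → ℝ) → ℝ} {y z : X}

theorem add (hy : IsCalcValue x f h y) (hz : IsCalcValue x f k z) :
    IsCalcValue x f (h + k) (y + z) := fun ε hε => by
  obtain ⟨p, hp, hp1, hp2⟩ := hy (ε / 2) (by positivity)
  obtain ⟨q, hq, hq1, hq2⟩ := hz (ε / 2) (by positivity)
  refine ⟨p + q, (isSublatticeSet_genSublattice x).add_mem hp hq, fun t => ?_, ?_⟩
  · rw [Pi.add_apply, Prod.fst_add, Pi.add_apply, add_sub_add_comm, ← add_halves ε, add_mul]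
    exact (abs_add_le _ _).trans (add_le_add (hp1 t) (hq1 t))
  · rw [Prod.snd_add, add_sub_add_comm, ← add_halves ε, add_smul]
    exact (abs_add_le _ _).trans (add_le_add hp2 hq2)

theorem sup (hy : IsCalcValue x f h y) (hz : IsCalcValue x f k z) :
    IsCalcValue x f (h ⊔ k) (y ⊔ z) := fun ε hε => by
  obtain ⟨p, hp, hp1, hp2⟩ := hy (ε / 2) (by positivity)
  obtain ⟨q, hq, hq1, hq2⟩ := hz (ε / 2) (by positivity)
  refine ⟨p ⊔ q, (isSublatticeSet_genSublattice x).sup_mem hp hq, fun t => ?_, ?_⟩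
  · rw [← add_halves ε, add_mul]
    exact (abs_sup_sub_sup_le_add _ _ _ _).trans (add_le_add (hp1 t) (hq1 t))
  · rw [← add_halves ε, add_smul]
    exact (abs_sup_sub_sup_le_add _ _ _ _).trans (add_le_add hp2 hq2)

variable [PosSMulMono ℝ X]

theorem of_mem_genSublattice (hf : 0 ≤ f) {p : ((Fin n → ℝ) → ℝ) × X}
    (hp : p ∈ genSublattice x) : IsCalcValue x f p.1 p.2 := fun ε hε =>
  ⟨p, hp, fun t => by simpa using mul_nonneg hε.le (norm_nonneg t),
    by simpa using smul_nonneg hε.le hf⟩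

theorem unique (harch : ∀ y z : X, 0 ≤ y → 0 ≤ z → (∀ k : ℕ, k • y ≤ z) → y = 0)
    (hf : supAbs x ≤ f) (hy : IsCalcValue x f h y) (hz : IsCalcValue x f h z) : y = z := by
  refine eq_of_forall_abs_sub_le_smul harch ((supAbs_nonneg x).trans hf) fun ε hε => ?_
  obtain ⟨p, hp, hp1, hp2⟩ := hy (ε / 4) (by positivity)
  obtain ⟨q, hq, hq1, hq2⟩ := hz (ε / 4) (by positivity)
  have hpq : |p.2 - q.2| ≤ (ε / 4 + ε / 4) • supAbs x :=
    abs_snd_sub_le_smul_supAbs hp hq fun t => by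
      rw [add_mul]
      refine (abs_sub_le _ (h t) _).trans (add_le_add ?_ (hq1 t))
      rw [abs_sub_comm]
      exact hp1 t
  calc |y - z| ≤ |y - p.2| + |p.2 - z| := abs_sub_le_add_abs_sub _ _ _
    _ ≤ |y - p.2| + (|p.2 - q.2| + |q.2 - z|) := by
        gcongr
        exact abs_sub_le_add_abs_sub _ _ _
    _ ≤ (ε / 4) • f + ((ε / 4 + ε / 4) • f + (ε / 4) • f) := by
        rw [abs_sub_comm q.2]
        exact add_le_add hp2 (add_le_add (hpq.trans (smul_le_smul_of_nonneg_left hf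
          (by positivity))) hq2)
    _ = ε • f := by module

theorem smul (hf : 0 ≤ f) (c : ℝ) (hy : IsCalcValue x f h y) :
    IsCalcValue x f (c • h) (c • y) := fun ε hε => by
  have hc : |c| * (ε / (|c| + 1)) ≤ ε := by
    rw [mul_div_assoc', div_le_iff₀ (by positivity)]
    nlinarith [abs_nonneg c]
  obtain ⟨p, hp, hp1, hp2⟩ := hy (ε / (|c| + 1)) (by positivity)
  refine ⟨c • p, (isSublatticeSet_genSublattice x).smul_mem c hp, fun t => ?_, ?_⟩
  · rw [Pi.smul_apply, Prod.smul_fst, Pi.smul_apply, smul_eq_mul, smul_eq_mul, ← mul_sub, abs_mul]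
    refine (mul_le_mul_of_nonneg_left (hp1 t) (abs_nonneg c)).trans ?_
    rw [← mul_assoc]
    exact mul_le_mul_of_nonneg_right hc (norm_nonneg t)
  · rw [Prod.smul_snd, ← smul_sub]
    refine (abs_smul_le c _).trans ((smul_le_smul_of_nonneg_left hp2 (abs_nonneg c)).trans ?_)
    rw [smul_smul]
    exact smul_le_smul_of_coeff_le hc hf

theorem exists_of_normComplete (hf : supAbs x ≤ f) {Y : Set X} (hY : IsSublatticeSet Y)
    (hx : ∀ i, x i ∈ Y) (hcomp : NormComplete f (Y ∩ idealSet f)) (hh : PosHomog n h) :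
    ∃ y, IsCalcValue x f h y := by
  have hf0 : 0 ≤ f := (supAbs_nonneg x).trans hf
  have hideal : IsSublatticeSet (idealSet f) := isSublatticeSet_idealSet f
  have hε : ∀ k : ℕ, (0 : ℝ) < 1 / ((k : ℝ) + 1) := fun k => Nat.one_div_pos_of_nat
  choose p hp hp1 using fun k : ℕ => exists_mem_genSublattice_abs_sub_le x hh (hε k)
  have hmem : ∀ k, (p k).2 ∈ Y ∩ idealSet f := fun k =>
    hp k _ (hY.inter hideal).preimage_snd fun i =>
      ⟨hx i, 1, zero_le_one, by simpa [coordPair] using (abs_le_supAbs x i).trans hf⟩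
  have hsmall : ∀ ε : ℝ, 0 < ε → ∃ N : ℕ, ∀ k : ℕ, N ≤ k → 1 / ((k : ℝ) + 1) < ε := fun ε hε => by
    obtain ⟨N, hN⟩ := exists_nat_one_div_lt hε
    exact ⟨N, fun k hk => (Nat.one_div_le_one_div hk).trans_lt hN⟩
  obtain ⟨y, hy, hlim⟩ := hcomp (fun k => (p k).2) hmem fun ε hε' => by
    obtain ⟨N, hN⟩ := hsmall (ε / 2) (by positivity)
    refine ⟨N, fun k l hk hl => (regNorm_le (add_nonneg (hε k).le (hε l).le) ?_).trans_lt
      (by linarith [hN k hk, hN l hl])⟩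
    refine (abs_snd_sub_le_smul_supAbs (hp k) (hp l) fun t => ?_).trans
      (smul_le_smul_of_nonneg_left hf (add_nonneg (hε k).le (hε l).le))
    rw [add_mul]
    refine (abs_sub_le _ (h t) _).trans (add_le_add ?_ (hp1 l t))
    rw [abs_sub_comm]
    exact hp1 k t
  refine ⟨y, fun ε hε' => ?_⟩
  obtain ⟨N, hN⟩ := hsmall ε hε'
  obtain ⟨M, hM⟩ := hlim ε hε'
  refine ⟨p (max N M), hp _, fun t => (hp1 _ t).trans ?_, ?_⟩
  · exact mul_le_mul_of_nonneg_right (hN _ (le_max_left _ _)).le (norm_nonneg t)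
  · rw [abs_sub_comm]
    exact abs_le_smul_of_regNorm_lt_s3 hf0 (hideal.sub_mem (hmem _).2 hy.2) (hM _ (le_max_right _ _))

end IsCalcValue

/-- A locally uniform limit, relative to the norm, of positively homogeneous functions. -/
theorem exists_posHomog_limit {H : ℕ → (Fin n → ℝ) → ℝ} (hH : ∀ k, PosHomog n (H k))
    (hstep : ∀ k t, |H k t - H (k + 1) t| ≤ ‖t‖ / 2 ^ k) :
    ∃ h, PosHomog n h ∧ ∀ k t, |H k t - h t| ≤ 2 / 2 ^ k * ‖t‖ := by
  have hdist : ∀ t k, dist (H k t) (H (k + 1) t) ≤ 2 * ‖t‖ / 2 / 2 ^ k := fun t k => by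
    rw [Real.dist_eq, mul_div_cancel_left₀ _ two_ne_zero]
    exact hstep k t
  choose h hlim using fun t =>
    cauchySeq_tendsto_of_complete (cauchySeq_of_le_geometric_two (hdist t))
  have hbound : ∀ k t, |H k t - h t| ≤ 2 / 2 ^ k * ‖t‖ := fun k t => by
    have := dist_le_of_le_geometric_two_of_tendsto (hdist t) (hlim t) k
    rwa [Real.dist_eq, mul_div_right_comm] at this
  refine ⟨h, ⟨?_, fun c hc t => ?_⟩, hbound⟩
  · refine continuous_of_locally_uniform_approx_of_continuousAt fun t u hu => ?_
    obtain ⟨ε, hε, hεu⟩ := Metric.mem_uniformity_dist.1 hu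
    obtain ⟨k, hk⟩ := exists_pow_lt_of_lt_one
      (show 0 < ε / (2 * (‖t‖ + 1)) by positivity) (show (1 / 2 : ℝ) < 1 by norm_num)
    refine ⟨Metric.ball t 1, Metric.ball_mem_nhds t one_pos, H k, (hH k).1.continuousAt,
      fun y hy => hεu ?_⟩
    have hy' : ‖y‖ ≤ ‖t‖ + 1 := by
      have := norm_le_norm_add_norm_sub' y t
      linarith [mem_ball_iff_norm.1 hy]
    rw [lt_div_iff₀ (by positivity), one_div, inv_pow] at hk
    rw [dist_comm, Real.dist_eq]
    calc |H k y - h y| ≤ 2 / 2 ^ k * ‖y‖ := hbound k y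
      _ ≤ 2 / 2 ^ k * (‖t‖ + 1) := by gcongr
      _ = (2 ^ k)⁻¹ * (2 * (‖t‖ + 1)) := by ring
      _ < ε := hk
  · refine tendsto_nhds_unique (hlim (c • t)) ?_
    simp only [fun k => (hH k).2 c hc t]
    exact (hlim t).const_mul c

/-- The graph of a map defined on the positively homogeneous functions. -/
def posHomogGraph (Φ : ∀ f : (Fin n → ℝ) → ℝ, PosHomog n f → X) :
    Set (((Fin n → ℝ) → ℝ) × X) := {p | ∃ hp : PosHomog n p.1, Φ p.1 hp = p.2}

namespace IsLatHom

variable {Φ : ∀ f : (Fin n → ℝ) → ℝ, PosHomog n f → X}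

theorem isSublatticeSet_graph (hΦ : IsLatHom (PosHomog n) Φ) :
    IsSublatticeSet (posHomogGraph Φ) := by
  have hP := isSublatticeSet_posHomog n
  have hsmul : ∀ (c : ℝ), ∀ p ∈ posHomogGraph Φ, c • p ∈ posHomogGraph Φ := fun c p ⟨hf, hy⟩ =>
    ⟨hP.smul_mem c hf, (hΦ.2.1 c p.1 hf _).trans (by rw [hy]; rfl)⟩
  refine .of_add_smul_sup ?_ (fun p ⟨hf, hy⟩ q ⟨hg, hz⟩ => ?_) hsmul
    fun p ⟨hf, hy⟩ q ⟨hg, hz⟩ => ?_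
  · simpa using hsmul 0 (0, Φ 0 hP.zero_mem) ⟨hP.zero_mem, rfl⟩
  · exact ⟨hP.add_mem hf hg, (hΦ.1 p.1 q.1 hf hg _).trans (by rw [hy, hz]; rfl)⟩
  · exact ⟨hP.sup_mem hf hg, (hΦ.2.2 p.1 q.1 hf hg _).trans (by rw [hy, hz]; rfl)⟩

theorem snd_nonneg_of_mem_graph (hΦ : IsLatHom (PosHomog n) Φ)
    {p : ((Fin n → ℝ) → ℝ) × X} (hp : p ∈ posHomogGraph Φ) (h : 0 ≤ p.1) : 0 ≤ p.2 := by
  have hS := hΦ.isSublatticeSet_graph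
  obtain ⟨f, y⟩ := p
  obtain ⟨hf, hy⟩ := hp
  obtain ⟨hf', hy'⟩ := hS.sup_mem (a := (f, y)) ⟨hf, hy⟩ hS.zero_mem
  simp only [Prod.fst_sup, Prod.fst_zero, Prod.snd_sup, Prod.snd_zero, sup_of_le_left h]
    at hf' hy' hy
  rw [← hy, hy']
  exact le_sup_right

variable {x : Fin n → X}

theorem isCalcValue [PosSMulMono ℝ X] (hΦ : IsLatHom (PosHomog n) Φ)
    (hx : ∀ i, coordPair x i ∈ posHomogGraph Φ) {h : (Fin n → ℝ) → ℝ} (hh : PosHomog n h) :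
    IsCalcValue x (supAbs x) h (Φ h hh) := fun ε hε => by
  obtain ⟨p, hp, hp1⟩ := exists_mem_genSublattice_abs_sub_le x hh hε
  have hS := hΦ.isSublatticeSet_graph
  exact ⟨p, hp, hp1, abs_snd_sub_le hS (fun _ => hΦ.snd_nonneg_of_mem_graph)
    (norm_supAbs_mem hS hx) (p := (h, Φ h hh)) ⟨hh, rfl⟩ (hp _ hS hx) hp1⟩

/-- Elements of the range bounded by `c • supAbs x` lift to functions bounded by `c * ‖·‖`. -/
theorem exists_mem_graph_abs_le [PosSMulMono ℝ X] (hΦ : IsLatHom (PosHomog n) Φ)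
    (hx : ∀ i, coordPair x i ∈ posHomogGraph Φ) {p : ((Fin n → ℝ) → ℝ) × X}
    (hp : p ∈ posHomogGraph Φ) {c : ℝ} (hc : 0 ≤ c) (h : |p.2| ≤ c • supAbs x) :
    ∃ q ∈ posHomogGraph Φ, q.2 = p.2 ∧ ∀ t, |q.1 t| ≤ c * ‖t‖ := by
  have hS := hΦ.isSublatticeSet_graph
  have hm := hS.smul_mem c (norm_supAbs_mem hS hx)
  refine ⟨_, hS.sup_mem (hS.inf_mem hp hm) (hS.neg_mem hm), ?_, fun t => ?_⟩
  · change p.2 ⊓ c • supAbs x ⊔ -(c • supAbs x) = p.2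
    rw [inf_of_le_left ((le_abs_self _).trans h)]
    exact sup_of_le_left (neg_le.1 ((neg_le_abs _).trans h))
  · have ht : 0 ≤ c * ‖t‖ := mul_nonneg hc (norm_nonneg t)
    change |p.1 t ⊓ c * ‖t‖ ⊔ -(c * ‖t‖)| ≤ c * ‖t‖
    exact abs_le.2 ⟨le_sup_right, sup_le inf_le_right (by linarith)⟩

theorem isSublatticeSet_range (hΦ : IsLatHom (PosHomog n) Φ) :
    IsSublatticeSet (Prod.snd '' posHomogGraph Φ) := by
  have hS := hΦ.isSublatticeSet_graph
  refine .of_add_smul_sup ⟨0, hS.zero_mem, rfl⟩ ?_ ?_ ?_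
  · rintro _ ⟨p, hp, rfl⟩ _ ⟨q, hq, rfl⟩
    exact ⟨p + q, hS.add_mem hp hq, rfl⟩
  · rintro c _ ⟨p, hp, rfl⟩
    exact ⟨c • p, hS.smul_mem c hp, rfl⟩
  · rintro _ ⟨p, hp, rfl⟩ _ ⟨q, hq, rfl⟩
    exact ⟨p ⊔ q, hS.sup_mem hp hq, rfl⟩

theorem normComplete_range [PosSMulMono ℝ X] (hΦ : IsLatHom (PosHomog n) Φ)
    (hx : ∀ i, coordPair x i ∈ posHomogGraph Φ) :
    NormComplete (supAbs x) (Prod.snd '' posHomogGraph Φ ∩ idealSet (supAbs x)) := by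
  intro u hu hcauchy
  have hS := hΦ.isSublatticeSet_graph
  have hR := hΦ.isSublatticeSet_range
  have he := supAbs_nonneg x
  have hideal : IsSublatticeSet (idealSet (supAbs x)) := isSublatticeSet_idealSet _
  choose N hN using fun k : ℕ => hcauchy (1 / 2 ^ k) (by positivity)
  let M : ℕ → ℕ := fun k => ∑ j ∈ Finset.range (k + 1), N j
  have hNM : ∀ k, N k ≤ M k := fun k =>
    Finset.single_le_sum (fun _ _ => Nat.zero_le _) (Finset.self_mem_range_succ k)
  have hMM : ∀ k, M k ≤ M (k + 1) := fun k => by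
    simp only [M, Finset.sum_range_succ _ (k + 1)]
    exact Nat.le_add_right _ _
  have hclose : ∀ k p q, N k ≤ p → N k ≤ q → |u p - u q| ≤ (1 / 2 ^ k : ℝ) • supAbs x :=
    fun k p q hp hq => abs_le_smul_of_regNorm_lt_s3 he (hideal.sub_mem (hu p).2 (hu q).2)
      (hN k p q hp hq)
  have hlift : ∀ k, ∃ q ∈ posHomogGraph Φ, q.2 = u (M (k + 1)) - u (M k) ∧
      ∀ t, |q.1 t| ≤ 1 / 2 ^ k * ‖t‖ := fun k => by
    obtain ⟨p, hp, hpu⟩ := hR.sub_mem (hu (M (k + 1))).1 (hu (M k)).1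
    rw [← hpu]
    refine hΦ.exists_mem_graph_abs_le hx hp (by positivity) (hpu ▸ ?_)
    exact hclose k _ _ ((hNM k).trans (hMM k)) (hNM k)
  choose g hg hgu hgb using hlift
  obtain ⟨p₀, hp₀, hp₀u⟩ := (hu (M 0)).1
  let P : ℕ → ((Fin n → ℝ) → ℝ) × X := fun k => p₀ + ∑ j ∈ Finset.range k, g j
  have hPsucc : ∀ k, P (k + 1) = P k + g k := fun k => by
    simp only [P, Finset.sum_range_succ, add_assoc]
  have hP : ∀ k, P k ∈ posHomogGraph Φ ∧ (P k).2 = u (M k) := fun k => by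
    induction k with
    | zero => simpa [P] using ⟨hp₀, hp₀u⟩
    | succ k ih =>
      rw [hPsucc]
      exact ⟨hS.add_mem ih.1 (hg k), by rw [Prod.snd_add, ih.2, hgu, add_sub_cancel]⟩
  obtain ⟨h, hh, hlim⟩ := exists_posHomog_limit (H := fun k => (P k).1) (fun k => (hP k).1.1)
    fun k t => by
      have hdiff : (P (k + 1)).1 t = (P k).1 t + (g k).1 t := by
        rw [hPsucc, Prod.fst_add, Pi.add_apply]
      rw [hdiff, sub_add_cancel_left, abs_neg, ← one_div_mul_eq_div]
      exact hgb k t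
  have hval : ∀ k, |u (M k) - Φ h hh| ≤ (2 / 2 ^ k : ℝ) • supAbs x := fun k => by
    rw [← (hP k).2]
    exact abs_snd_sub_le hS (fun _ => hΦ.snd_nonneg_of_mem_graph) (norm_supAbs_mem hS hx)
      (hP k).1 (q := (h, Φ h hh)) ⟨hh, rfl⟩ (hlim k)
  have hmem : Φ h hh ∈ idealSet (supAbs x) := by
    have := hideal.sub_mem (hu (M 0)).2 (b := u (M 0) - Φ h hh) ⟨_, by positivity, hval 0⟩
    rwa [sub_sub_cancel] at this
  refine ⟨Φ h hh, ⟨⟨(h, Φ h hh), ⟨hh, rfl⟩, rfl⟩, hmem⟩, fun ε hε => ?_⟩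
  obtain ⟨k, hk⟩ := exists_pow_lt_of_lt_one (show 0 < ε / 3 by positivity)
    (show (1 / 2 : ℝ) < 1 by norm_num)
  refine ⟨N k, fun p hp => (regNorm_le (c := 1 / 2 ^ k + 2 / 2 ^ k) (by positivity) ?_).trans_lt ?_⟩
  · rw [add_smul]
    exact (abs_sub_le_add_abs_sub _ (u (M k)) _).trans
      (add_le_add (hclose k _ _ hp (hNM k)) (hval k))
  · rw [one_div_pow] at hk
    calc (1 / 2 ^ k + 2 / 2 ^ k : ℝ) = 3 * (1 / 2 ^ k) := by ring
      _ < ε := by linarith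

end IsLatHom

end FunctionCalculus

/-- Laustsen–Troitsky characterization of positively homogeneous
continuous function calculus for Archimedean vector lattices. -/
theorem stmt_3 {X : Type*} [Lattice X] [AddCommGroup X] [Module ℝ X]
    [CovariantClass X X (· + ·) (· ≤ ·)]
    (hsmulpos : ∀ (c : ℝ) (y : X), 0 ≤ c → 0 ≤ y → 0 ≤ c • y)
    (harch : ∀ y z : X, 0 ≤ y → 0 ≤ z → (∀ k : ℕ, k • y ≤ z) → y = 0)
    (n : ℕ) (x : Fin n → X) :
    let C1 : Prop := ∃ Φ : ∀ f : (Fin n → ℝ) → ℝ, PosHomog n f → X,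
      IsLatHom (PosHomog n) Φ ∧
      ∀ (i : Fin n) (hi : PosHomog n fun t => t i), Φ (fun t => t i) hi = x i
    let e : X := Finset.univ.fold (· ⊔ ·) 0 fun i => |x i|
    let C2 : Prop := ∃ Y : Set X, IsSublatticeSet Y ∧ (∀ i, x i ∈ Y) ∧
      NormComplete e (Y ∩ idealSet e)
    let C3 : Prop := ∃ f : X, e ≤ f ∧ ∃ Y : Set X, IsSublatticeSet Y ∧ (∀ i, x i ∈ Y) ∧
      NormComplete f (Y ∩ idealSet f)
    ((C1 ↔ C2) ∧ (C2 ↔ C3)) ∧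
    (∀ Φ₁ Φ₂ : ∀ f : (Fin n → ℝ) → ℝ, PosHomog n f → X,
      IsLatHom (PosHomog n) Φ₁ → IsLatHom (PosHomog n) Φ₂ →
      (∀ (i : Fin n) (hi : PosHomog n fun t => t i), Φ₁ (fun t => t i) hi = x i) →
      (∀ (i : Fin n) (hi : PosHomog n fun t => t i), Φ₂ (fun t => t i) hi = x i) →
      ∀ (f : (Fin n → ℝ) → ℝ) (hf : PosHomog n f), Φ₁ f hf = Φ₂ f hf) := by
  intro C1 e C2 C3
  have : IsOrderedAddMonoid X :=
    { add_le_add_left := fun a b hab c => by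
        rw [add_comm a, add_comm b]
        exact CovariantClass.elim c hab }
  have : PosSMulMono ℝ X := ⟨fun c hc a b hab => by
    rw [← sub_nonneg, ← smul_sub]
    exact hsmulpos c _ hc (sub_nonneg.2 hab)⟩
  have coord_mem : ∀ Φ : ∀ f : (Fin n → ℝ) → ℝ, PosHomog n f → X,
      (∀ (i : Fin n) (hi : PosHomog n fun t => t i), Φ (fun t => t i) hi = x i) →
      ∀ i, coordPair x i ∈ posHomogGraph Φ := fun Φ hx i => ⟨posHomog_apply i, hx i _⟩
  have h12 : C1 → C2 := by
    rintro ⟨Φ, hΦ, hx⟩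
    exact ⟨Prod.snd '' posHomogGraph Φ, hΦ.isSublatticeSet_range,
      fun i => ⟨_, coord_mem Φ hx i, rfl⟩, hΦ.normComplete_range (coord_mem Φ hx)⟩
  have h23 : C2 → C3 := fun h => ⟨e, le_rfl, h⟩
  have h31 : C3 → C1 := by
    rintro ⟨f, hf, Y, hY, hx, hcomp⟩
    have hf0 : 0 ≤ f := (supAbs_nonneg x).trans hf
    choose Φ hΦ using fun (h : (Fin n → ℝ) → ℝ) (hh : PosHomog n h) =>
      IsCalcValue.exists_of_normComplete hf hY hx hcomp hh
    refine ⟨Φ, ⟨fun h k hh hk hhk => ?_, fun c h hh hch => ?_, fun h k hh hk hhk => ?_⟩,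
      fun i hi => ?_⟩
    · exact (hΦ _ hhk).unique harch hf ((hΦ h hh).add (hΦ k hk))
    · exact (hΦ _ hch).unique harch hf ((hΦ h hh).smul hf0 c)
    · exact (hΦ _ hhk).unique harch hf ((hΦ h hh).sup (hΦ k hk))
    · exact (hΦ _ hi).unique harch hf
        (IsCalcValue.of_mem_genSublattice hf0 (coordPair_mem_genSublattice x i))
  refine ⟨⟨⟨h12, h31 ∘ h23⟩, h23, h12 ∘ h31⟩, fun Φ₁ Φ₂ h₁ h₂ hx₁ hx₂ f hf => ?_⟩
  exact (h₁.isCalcValue (coord_mem Φ₁ hx₁) hf).unique harch le_rfl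
    (h₂.isCalcValue (coord_mem Φ₂ hx₂) hf)
end
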